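/- arXiv:1706.08765 — 8 statements merged into one kernel-verified Lean document; each statement's English description precedes it below -/
import Mathlib

section
/- The set R_0 = {α ∈ R : c_j(α) ∈ {0, a_j, −a_j}} satisfies −R_0 = R_0 and is closed in R (if α, β ∈ R_0 and α + β ∈ R, then α + β ∈ R_0); moreover the set {α_i : 1 ≤ i ≤ n, i ≠ j} ∪ {−θ} is linearly independent and every element of R_0 is an integer linear combination of its elements in which the coefficients are either all nonnegative or all nonpositive (i.e. {α_i : i ≠ j} ∪ {−θ} is a base of the root system R_0). -/
open RealInnerProductSpace

/-- Expanding in the family `α` a combination of the family obtained from `α` by replacing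
`α j` with the negative of `∑ i, t i • α i`. -/
theorem sum_smul_replace_neg {ι 𝕜 V : Type*} [Fintype ι] [DecidableEq ι] [CommRing 𝕜]
    [AddCommGroup V] [Module 𝕜 V] (α : ι → V) (t g : ι → 𝕜) (θ : V)
    (hθ : θ = ∑ i, t i • α i) (j : ι) :
    ∑ i, g i • (if i = j then -θ else α i) =
      ∑ i, ((if i = j then 0 else g i) - g j * t i) • α i := by
  have h : ∀ i, g i • (if i = j then -θ else α i) =
      (if i = j then 0 else g i) • α i + (if i = j then -(g j • θ) else 0) := by
    intro i
    split_ifs with hi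
    · subst hi; simp
    · simp
  simp only [h, Finset.sum_add_distrib, Finset.sum_ite_eq', Finset.mem_univ, if_true, sub_smul,
    Finset.sum_sub_distrib, mul_smul, ← Finset.smul_sum, ← hθ]
  abel

/-- Replacing `α j` by the negative of a combination whose `j`-th coefficient is nonzero keeps
a family linearly independent. -/
theorem linearIndependent_replace_neg {ι 𝕜 V : Type*} [Fintype ι] [DecidableEq ι] [Field 𝕜]
    [AddCommGroup V] [Module 𝕜 V] {α : ι → V} (hα : LinearIndependent 𝕜 α) (t : ι → 𝕜) (θ : V)
    (hθ : θ = ∑ i, t i • α i) (j : ι) (hj : t j ≠ 0) :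
    LinearIndependent 𝕜 (fun i => if i = j then -θ else α i) := by
  rw [Fintype.linearIndependent_iff] at hα ⊢
  intro g hg
  rw [sum_smul_replace_neg α t g θ hθ j] at hg
  have h := hα _ hg
  have hgj : g j = 0 := by simpa [hj] using h j
  intro i
  by_cases hi : i = j
  · rw [hi, hgj]
  · simpa [hi, hgj] using h i

/-- Let `R` be a finite, reduced, irreducible, crystallographic root system
spanning a finite-dimensional real inner product space, with base `Δ = {α 1, …, α n}`,
positive roots `R⁺`, highest root `θ`, coefficients `c β i` (so `β = ∑ i, c β i • α i`),
and `a i = c θ i`.  Fix `j` with `a j ≥ 2` and set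
`R₀ = {β ∈ R : c β j ∈ {0, a j, -(a j)}}`.  Then `-R₀ = R₀`, `R₀` is closed in `R`,
the set `{α i : i ≠ j} ∪ {-θ}` is linearly independent, and every element of `R₀` is an
integer linear combination of these elements with coefficients all nonnegative or all
nonpositive. -/
theorem statement0
    {V : Type*} [NormedAddCommGroup V] [InnerProductSpace ℝ V] [FiniteDimensional ℝ V]
    (R : Set V) (hRfin : R.Finite) (hR0 : (0 : V) ∉ R)
    (hRspan : Submodule.span ℝ R = ⊤)
    (hRneg : ∀ β ∈ R, -β ∈ R)
    (hRrefl : ∀ β ∈ R, ∀ γ ∈ R, γ - (2 * ⟪γ, β⟫ / ⟪β, β⟫) • β ∈ R)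
    (hRcrys : ∀ β ∈ R, ∀ γ ∈ R, ∃ k : ℤ, 2 * ⟪γ, β⟫ / ⟪β, β⟫ = (k : ℝ))
    (hRred : ∀ β ∈ R, ∀ s : ℝ, s • β ∈ R → s = 1 ∨ s = -1)
    (hRirr : ∀ R₁ R₂ : Set V, R = R₁ ∪ R₂ → (∀ a ∈ R₁, ∀ b ∈ R₂, ⟪a, b⟫ = 0) →
      R₁ = ∅ ∨ R₂ = ∅)
    (n : ℕ) (α : Fin n → V) (hα : ∀ i, α i ∈ R)
    (hαind : LinearIndependent ℝ α)
    (c : V → Fin n → ℤ)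
    (hc : ∀ β ∈ R, β = ∑ i, (c β i : ℝ) • α i)
    (hbase : ∀ β ∈ R, (∀ i, 0 ≤ c β i) ∨ (∀ i, c β i ≤ 0))
    (θ : V) (hθ : θ ∈ R) (hθhigh : ∀ β ∈ R, ∀ i, c β i ≤ c θ i)
    (j : Fin n) (haj : 2 ≤ c θ j)
    (R₀ : Set V)
    (hR₀ : R₀ = {β ∈ R | c β j = 0 ∨ c β j = c θ j ∨ c β j = -(c θ j)})
    (δ : Fin n → V) (hδ : δ = fun i => if i = j then -θ else α i) :
    (∀ β ∈ R₀, -β ∈ R₀) ∧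
    (∀ β ∈ R₀, ∀ γ ∈ R₀, β + γ ∈ R → β + γ ∈ R₀) ∧
    LinearIndependent ℝ δ ∧
    (∀ β ∈ R₀, ∃ d : Fin n → ℤ, β = ∑ i, (d i : ℝ) • δ i ∧
      ((∀ i, 0 ≤ d i) ∨ (∀ i, d i ≤ 0))) := by
  have hcoef : ∀ (β : V) (f : Fin n → ℤ), β ∈ R → β = ∑ i, (f i : ℝ) • α i → c β = f := by
    intro β f hβ hf
    funext i
    have h := Fintype.linearIndependent_iff.mp hαind (fun i => (c β i : ℝ) - f i)
      (by simp only [sub_smul, Finset.sum_sub_distrib, ← hc β hβ, ← hf, sub_self]) i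
    exact_mod_cast sub_eq_zero.mp h
  have hcneg : ∀ β ∈ R, ∀ i, c (-β) i = -c β i := by
    intro β hβ i
    refine congrFun (hcoef (-β) (fun i => -c β i) (hRneg β hβ) ?_) i
    simp only [Int.cast_neg, neg_smul, Finset.sum_neg_distrib, ← hc β hβ]
  have hcadd : ∀ β ∈ R, ∀ γ ∈ R, β + γ ∈ R → ∀ i, c (β + γ) i = c β i + c γ i := by
    intro β hβ γ hγ hβγ i
    refine congrFun (hcoef (β + γ) (fun i => c β i + c γ i) hβγ ?_) i
    simp only [Int.cast_add, add_smul, Finset.sum_add_distrib, ← hc β hβ, ← hc γ hγ]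
  have hlow : ∀ β ∈ R, ∀ i, -c θ i ≤ c β i := by
    intro β hβ i
    have h := hθhigh _ (hRneg β hβ) i
    rw [hcneg β hβ] at h
    omega
  subst hR₀ hδ
  refine ⟨?_, ?_, ?_, ?_⟩
  · rintro β ⟨hβ, h⟩
    refine ⟨hRneg β hβ, ?_⟩
    rw [hcneg β hβ]
    omega
  · rintro β ⟨hβ, h⟩ γ ⟨hγ, h'⟩ hβγ
    refine ⟨hβγ, ?_⟩
    have h1 := hθhigh _ hβγ j
    have h2 := hlow _ hβγ j
    rw [hcadd β hβ γ hγ hβγ] at h1 h2 ⊢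
    omega
  · refine linearIndependent_replace_neg hαind (fun i => (c θ i : ℝ)) θ (hc θ hθ) j ?_
    have : c θ j ≠ 0 := by omega
    exact_mod_cast this
  · have key : ∀ β ∈ R, ∀ m : ℤ, c β j = m * c θ j →
        β = ∑ i, ((if i = j then -m else c β i - m * c θ i : ℤ) : ℝ) •
          (if i = j then -θ else α i) := by
      intro β hβ m hm
      rw [sum_smul_replace_neg α (fun i => (c θ i : ℝ)) _ θ (hc θ hθ) j]
      conv_lhs => rw [hc β hβ]
      refine Finset.sum_congr rfl fun i _ => ?_
      congr 1
      by_cases hi : i = j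
      · subst hi
        simp [hm]
      · simp [hi]
    rintro β ⟨hβ, h | h | h⟩
    · refine ⟨_, key β hβ 0 (by simpa using h), (hbase β hβ).imp ?_ ?_⟩ <;>
      · intro hs i
        have := hs i
        split_ifs <;> omega
    · refine ⟨_, key β hβ 1 (by simpa using h), Or.inr fun i => ?_⟩
      have := hθhigh β hβ i
      split_ifs <;> omega
    · refine ⟨_, key β hβ (-1) (by simpa using h), Or.inl fun i => ?_⟩
      have := hlow β hβ i
      split_ifs <;> omega
end

section
/- The set {α ∈ R^+ : c_j(α) = a_j} is nonempty and contains a unique element α_0 of minimal height. Moreover Δ_0 := {α_i : i ≠ j} ∪ {α_0} is linearly independent, every element of R_0 is an integer linear combination of elements of Δ_0 with coefficients all nonnegative or all nonpositive (i.e. Δ_0 is a base of R_0), and every element of R_0 that is a nonnegative integer combination of elements of Δ_0 lies in R^+. -/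
open RealInnerProductSpace

/-- In a reduced crystallographic root system, the difference of two distinct roots at an acute
angle is a root. -/
theorem root_sub_mem_of_inner_pos
    {V : Type*} [NormedAddCommGroup V] [InnerProductSpace ℝ V] {R : Set V}
    (hR0 : (0 : V) ∉ R) (hRneg : ∀ β ∈ R, -β ∈ R)
    (hRrefl : ∀ β ∈ R, ∀ γ ∈ R, γ - (2 * ⟪γ, β⟫ / ⟪β, β⟫) • β ∈ R)
    (hRcrys : ∀ β ∈ R, ∀ γ ∈ R, ∃ k : ℤ, 2 * ⟪γ, β⟫ / ⟪β, β⟫ = (k : ℝ))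
    (hRred : ∀ β ∈ R, ∀ s : ℝ, s • β ∈ R → s = 1 ∨ s = -1)
    {β γ : V} (hβ : β ∈ R) (hγ : γ ∈ R) (hpos : 0 < ⟪β, γ⟫) (hne : β ≠ γ) : β - γ ∈ R := by
  have hβ0 : β ≠ 0 := fun h => hR0 (h ▸ hβ)
  have hγ0 : γ ≠ 0 := fun h => hR0 (h ▸ hγ)
  have hββ : 0 < ⟪β, β⟫ := real_inner_self_pos.2 hβ0
  have hγγ : 0 < ⟪γ, γ⟫ := real_inner_self_pos.2 hγ0
  have hnp : ∀ s : ℝ, β ≠ s • γ := by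
    rintro s rfl
    rcases hRred γ hγ s hβ with rfl | rfl
    · simp at hne
    · simp only [neg_smul, one_smul, inner_neg_left] at hpos
      linarith
  have hcs : ⟪β, γ⟫ * ⟪β, γ⟫ < ⟪β, β⟫ * ⟪γ, γ⟫ := by
    have h0 : β - (⟪β, γ⟫ / ⟪γ, γ⟫) • γ ≠ 0 := fun h => hnp _ (sub_eq_zero.1 h)
    have h1 := real_inner_self_pos.2 h0
    simp only [inner_sub_left, inner_sub_right, real_inner_smul_left, real_inner_smul_right,
      real_inner_comm β γ] at h1
    have h2 := mul_pos h1 hγγ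
    field_simp at h2
    nlinarith
  obtain ⟨k, hk⟩ := hRcrys γ hγ β hβ
  obtain ⟨l, hl⟩ := hRcrys β hβ γ hγ
  have hr1 := hRrefl γ hγ β hβ
  have hr2 := hRrefl β hβ γ hγ
  rw [hk] at hr1
  rw [hl] at hr2
  rw [real_inner_comm] at hl
  have hk0 : (0 : ℝ) < k := by rw [← hk]; positivity
  have hl0 : (0 : ℝ) < l := by rw [← hl]; positivity
  have hkl : (k : ℝ) * l < 4 := by
    rw [← hk, ← hl, div_mul_div_comm, div_lt_iff₀ (by positivity)]
    nlinarith
  norm_cast at hk0 hl0 hkl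
  have : k = 1 ∨ l = 1 := by
    by_contra! h
    have h2 : 2 ≤ k := by omega
    have h3 : 2 ≤ l := by omega
    nlinarith
  rcases this with rfl | rfl
  · simpa using hr1
  · simpa using hRneg _ hr2

/-- A set `R` of roots with a base `α` and integral coordinates `c` relative to it, in which
differences of distinct roots at acute angles are again roots. -/
structure IsBasedRootSet {V : Type*} [NormedAddCommGroup V] [InnerProductSpace ℝ V]
    (R : Set V) {n : ℕ} (α : Fin n → V) (c : V → Fin n → ℤ) : Prop where
  zero_notMem : (0 : V) ∉ R
  neg_mem : ∀ β ∈ R, -β ∈ R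
  sub_mem : ∀ β ∈ R, ∀ γ ∈ R, 0 < ⟪β, γ⟫ → β ≠ γ → β - γ ∈ R
  simple_mem : ∀ i, α i ∈ R
  linearIndependent : LinearIndependent ℝ α
  eq_sum : ∀ β ∈ R, β = ∑ i, (c β i : ℝ) • α i
  coeff_sign : ∀ β ∈ R, (∀ i, 0 ≤ c β i) ∨ (∀ i, c β i ≤ 0)

namespace IsBasedRootSet

variable {V : Type*} [NormedAddCommGroup V] [InnerProductSpace ℝ V]
  {R : Set V} {n : ℕ} {α : Fin n → V} {c : V → Fin n → ℤ}

theorem add_mem (h : IsBasedRootSet R α c) {β γ : V} (hβ : β ∈ R) (hγ : γ ∈ R)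
    (hneg : ⟪β, γ⟫ < 0) : β + γ ∈ R ∨ β + γ = 0 := by
  by_cases h0 : β + γ = 0
  · exact Or.inr h0
  · left
    have := h.sub_mem β hβ (-γ) (h.neg_mem γ hγ) (by rw [inner_neg_right]; linarith)
      (fun e => h0 (by rw [e]; simp))
    simpa using this

/-- If `x + y + z` and `y + z` are roots, then so is `x + y` or `x + z`, up to vanishing. -/
theorem add_mem_or_add_mem (h : IsBasedRootSet R α c) {x y z : V} (hx : x ∈ R) (hy : y ∈ R)
    (hz : z ∈ R) (hyz : y + z ∈ R) (hs : x + y + z ∈ R) :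
    (x + y ∈ R ∨ x + y = 0) ∨ (x + z ∈ R ∨ x + z = 0) := by
  by_cases hxy : ⟪x, y⟫ < 0
  · exact Or.inl (h.add_mem hx hy hxy)
  by_cases hxz : ⟪x, z⟫ < 0
  · exact Or.inr (h.add_mem hx hz hxz)
  have hyz0 : 0 < ⟪y + z, y + z⟫ :=
    real_inner_self_pos.2 fun e => h.zero_notMem (e ▸ hyz)
  have key : 0 < ⟪x + y + z, y⟫ ∨ 0 < ⟪x + y + z, z⟫ := by
    by_contra! hc
    simp only [inner_add_left, inner_add_right] at hc hyz0
    linarith [hc.1, hc.2]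
  rcases key with hp | hp
  · right
    by_cases he : x + y + z = y
    · right
      have : x + y + z - y = 0 := sub_eq_zero.2 he
      rw [← this]; abel
    · left
      have := h.sub_mem _ hs _ hy hp he
      rwa [show x + y + z - y = x + z by abel] at this
  · left
    by_cases he : x + y + z = z
    · right
      have : x + y + z - z = 0 := sub_eq_zero.2 he
      rw [← this]; abel
    · left
      have := h.sub_mem _ hs _ hz hp he
      rwa [show x + y + z - z = x + y by abel] at this

theorem coeff_eq (h : IsBasedRootSet R α c) {β : V} (hβ : β ∈ R) {d : Fin n → ℤ}
    (hd : β = ∑ i, (d i : ℝ) • α i) (i : Fin n) : c β i = d i := by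
  have h1 := (h.eq_sum β hβ).symm.trans hd
  have h2 : ∑ i, ((c β i : ℝ) - d i) • α i = 0 := by
    simp only [sub_smul, Finset.sum_sub_distrib, h1, sub_self]
  have h3 := Fintype.linearIndependent_iff.1 h.linearIndependent _ h2 i
  exact_mod_cast sub_eq_zero.1 h3

theorem eq_of_coeff_eq (h : IsBasedRootSet R α c) {β γ : V} (hβ : β ∈ R) (hγ : γ ∈ R)
    (hc : ∀ i, c β i = c γ i) : β = γ := by
  rw [h.eq_sum β hβ, h.eq_sum γ hγ]
  simp only [hc]

theorem coeff_neg (h : IsBasedRootSet R α c) {β : V} (hβ : β ∈ R) (i : Fin n) :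
    c (-β) i = -c β i :=
  h.coeff_eq (d := fun i => -c β i) (h.neg_mem β hβ) (by
    conv_lhs => rw [h.eq_sum β hβ]
    simp) i

theorem coeff_add (h : IsBasedRootSet R α c) {β γ : V} (hβ : β ∈ R) (hγ : γ ∈ R)
    (hs : β + γ ∈ R) (i : Fin n) : c (β + γ) i = c β i + c γ i :=
  h.coeff_eq (d := fun i => c β i + c γ i) hs (by
    conv_lhs => rw [h.eq_sum β hβ, h.eq_sum γ hγ]
    simp [add_smul, Finset.sum_add_distrib]) i

theorem coeff_sub (h : IsBasedRootSet R α c) {β γ : V} (hβ : β ∈ R) (hγ : γ ∈ R)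
    (hs : β - γ ∈ R) (i : Fin n) : c (β - γ) i = c β i - c γ i := by
  rw [sub_eq_add_neg] at hs ⊢
  rw [h.coeff_add hβ (h.neg_mem γ hγ) hs, h.coeff_neg hγ, sub_eq_add_neg]

theorem coeff_simple (h : IsBasedRootSet R α c) (i k : Fin n) :
    c (α i) k = if k = i then 1 else 0 :=
  h.coeff_eq (d := fun k => if k = i then 1 else 0) (h.simple_mem i) (by simp) k

theorem inner_eq_sum (h : IsBasedRootSet R α c) (x : V) {β : V} (hβ : β ∈ R) :
    ⟪x, β⟫ = ∑ i, (c β i : ℝ) * ⟪x, α i⟫ := by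
  conv_lhs => rw [h.eq_sum β hβ]
  simp only [inner_sum, real_inner_smul_right]

/-- A positive root that is not simple remains a positive root after subtracting some simple
root of its support. -/
theorem exists_sub_simple_mem (h : IsBasedRootSet R α c) {δ : V} (hδ : δ ∈ R)
    (hpos : ∀ i, 0 ≤ c δ i) (hns : ∀ i, δ ≠ α i) :
    ∃ i, 0 < c δ i ∧ δ - α i ∈ R ∧ ∀ k, 0 ≤ c (δ - α i) k := by
  have hδδ : 0 < ⟪δ, δ⟫ := real_inner_self_pos.2 fun e => h.zero_notMem (e ▸ hδ)
  rw [h.inner_eq_sum δ hδ] at hδδ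
  obtain ⟨i, -, hi⟩ := Finset.exists_lt_of_sum_lt (s := Finset.univ) (f := fun _ : Fin n => (0 : ℝ))
    (by simpa using hδδ)
  have hci : (0 : ℝ) ≤ c δ i := by exact_mod_cast hpos i
  have hip : 0 < ⟪δ, α i⟫ := pos_of_mul_pos_right hi hci
  have hc0 : 0 < c δ i := by exact_mod_cast pos_of_mul_pos_left hi hip.le
  have hm := h.sub_mem δ hδ _ (h.simple_mem i) hip (hns i)
  refine ⟨i, hc0, hm, fun k => ?_⟩
  rw [h.coeff_sub hδ (h.simple_mem i) hm, h.coeff_simple]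
  have := hpos k
  split_ifs with hk
  · subst hk; omega
  · omega

/-- If a positive root `δ` with vanishing `j`-th coefficient can be subtracted from a root `γ`
with nonzero `j`-th coefficient, then so can a simple root other than `α j`. -/
theorem exists_simple_sub_mem (h : IsBasedRootSet R α c) {j : Fin n} {γ : V} (hγ : γ ∈ R)
    (hγj : c γ j ≠ 0) (N : ℕ) : ∀ δ ∈ R, (∀ i, 0 ≤ c δ i) → c δ j = 0 → ∑ i, c δ i ≤ N →
      γ - δ ∈ R → ∃ i, i ≠ j ∧ γ - α i ∈ R := by
  induction N with
  | zero =>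
    intro δ hδ hpos hj hN _
    exfalso
    have hz : ∑ i, c δ i = 0 :=
      le_antisymm (by simpa using hN) (Finset.sum_nonneg fun i _ => hpos i)
    have hz' := (Finset.sum_eq_zero_iff_of_nonneg fun i _ => hpos i).1 hz
    apply h.zero_notMem
    have := h.eq_sum δ hδ
    simp only [fun i => hz' i (Finset.mem_univ i), Int.cast_zero, zero_smul,
      Finset.sum_const_zero] at this
    exact this ▸ hδ
  | succ N ih =>
    intro δ hδ hpos hj hN hm
    by_cases hns : ∀ i, δ ≠ α i
    · obtain ⟨i, hi, hδi, hδpos⟩ := h.exists_sub_simple_mem hδ hpos hns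
      have hij : i ≠ j := by rintro rfl; omega
      have hcoeff := h.coeff_sub hδ (h.simple_mem i) hδi
      have hδj : c (δ - α i) j = 0 := by
        rw [hcoeff, h.coeff_simple, if_neg hij.symm, hj, sub_zero]
      have hnz : ∀ ε ∈ R, c ε j = 0 → γ + -ε ≠ 0 := by
        intro ε _ hεj he
        have : γ = ε := by rwa [← sub_eq_add_neg, sub_eq_zero] at he
        exact hγj (this ▸ hεj)
      rcases h.add_mem_or_add_mem (y := -(δ - α i)) (z := -α i) hγ (h.neg_mem _ hδi)
        (h.neg_mem _ (h.simple_mem i))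
        (by rw [show -(δ - α i) + -α i = -δ by abel]; exact h.neg_mem _ hδ)
        (by rwa [show γ + -(δ - α i) + -α i = γ - δ by abel]) with (h1 | h1) | (h1 | h1)
      · refine ih (δ - α i) hδi hδpos hδj ?_ (by rwa [sub_eq_add_neg])
        simp only [hcoeff, Finset.sum_sub_distrib, h.coeff_simple, Finset.sum_ite_eq',
          Finset.mem_univ, if_true]
        push_cast at hN
        omega
      · exact absurd h1 (hnz _ hδi hδj)
      · exact ⟨i, hij, by rwa [sub_eq_add_neg]⟩
      · exact absurd h1 (hnz _ (h.simple_mem i) (by rw [h.coeff_simple, if_neg hij.symm]))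
    · push Not at hns
      obtain ⟨i, rfl⟩ := hns
      refine ⟨i, ?_, hm⟩
      rintro rfl
      simp [h.coeff_simple] at hj

theorem coeff_nonneg_of_pos (h : IsBasedRootSet R α c) {β : V} (hβ : β ∈ R) {j : Fin n}
    (hj : 0 < c β j) (i : Fin n) : 0 ≤ c β i := by
  rcases h.coeff_sign β hβ with hs | hs
  · exact hs i
  · have := hs j
    omega

/-- Distinct simple roots form an obtuse angle. -/
theorem inner_simple_nonpos (h : IsBasedRootSet R α c) {i k : Fin n} (hik : i ≠ k) :
    ⟪α i, α k⟫ ≤ 0 := by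
  by_contra! hp
  have hm := h.sub_mem _ (h.simple_mem i) _ (h.simple_mem k) hp
    (h.linearIndependent.injective.ne hik)
  have hco := h.coeff_sub (h.simple_mem i) (h.simple_mem k) hm
  simp only [h.coeff_simple] at hco
  have h1 := hco i
  have h2 := hco k
  simp only [if_true, if_neg hik, if_neg hik.symm] at h1 h2
  rcases h.coeff_sign _ hm with hs | hs
  · have := hs k; omega
  · have := hs i; omega

/-- A root from which `α i` cannot be subtracted forms an obtuse angle with it. -/
theorem inner_simple_nonpos_of_sub_notMem (h : IsBasedRootSet R α c) {j : Fin n} {γ : V}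
    (hγ : γ ∈ R) (hγj : c γ j ≠ 0) {i : Fin n} (hi : i ≠ j) (hlow : γ - α i ∉ R) :
    ⟪γ, α i⟫ ≤ 0 := by
  by_contra! hp
  refine hlow (h.sub_mem γ hγ _ (h.simple_mem i) hp ?_)
  rintro rfl
  exact hγj (by rw [h.coeff_simple, if_neg hi.symm])

theorem inner_nonneg_of_highest (h : IsBasedRootSet R α c) {θ : V}
    (hhigh : ∀ β ∈ R, ∀ i, c β i ≤ c θ i) {j : Fin n} (hj : 0 < c θ j) {β γ : V} (hβ : β ∈ R)
    (hγ : γ ∈ R) (hβj : c β j = c θ j) (hγj : 0 < c γ j) : 0 ≤ ⟪β, γ⟫ := by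
  by_contra! hp
  rcases h.add_mem hβ hγ hp with hs | hs
  · have h1 := hhigh _ hs j
    rw [h.coeff_add hβ hγ hs] at h1
    omega
  · rw [eq_neg_of_add_eq_zero_left hs, h.coeff_neg hγ] at hβj
    omega

/-- The highest root is dominant. -/
theorem inner_highest_nonneg (h : IsBasedRootSet R α c) {θ : V} (hθ : θ ∈ R)
    (hhigh : ∀ β ∈ R, ∀ i, c β i ≤ c θ i) (i : Fin n) : 0 ≤ ⟪θ, α i⟫ := by
  have h1 : 0 < c θ i := by
    have := hhigh _ (h.simple_mem i) i
    rw [h.coeff_simple, if_pos rfl] at this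
    omega
  exact h.inner_nonneg_of_highest hhigh h1 hθ (h.simple_mem i) rfl
    (by rw [h.coeff_simple, if_pos rfl]; omega)

/-- Let `γ` be a root with top `j`-th coefficient that is antidominant away from `j`, and
orthogonal to another root `γ'` with top `j`-th coefficient. Then `γ` is orthogonal to the
highest root and to every simple root `α i`, `i ≠ j`, outside the support of `γ'`. -/
theorem orthogonal_highest (h : IsBasedRootSet R α c) {θ : V} (hθ : θ ∈ R)
    (hhigh : ∀ β ∈ R, ∀ i, c β i ≤ c θ i) {j : Fin n} (hj : 0 < c θ j) {γ γ' : V}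
    (hγ : γ ∈ R) (hγ' : γ' ∈ R) (hγj : c γ j = c θ j) (hγ'j : c γ' j = c θ j)
    (hanti : ∀ i, i ≠ j → ⟪γ, α i⟫ ≤ 0) (horth : ⟪γ, γ'⟫ = 0) :
    ⟪γ, θ⟫ = 0 ∧ ∀ i, c γ' i = 0 → ⟪γ, α i⟫ = 0 := by
  have hterm : ∀ i ∈ Finset.univ, ((c θ i : ℝ) - c γ' i) * ⟪γ, α i⟫ ≤ 0 := by
    intro i _
    by_cases hi : i = j
    · subst hi; simp [hγ'j]
    · have : (c γ' i : ℝ) ≤ c θ i := by exact_mod_cast hhigh γ' hγ' i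
      exact mul_nonpos_of_nonneg_of_nonpos (by linarith) (hanti i hi)
  have hsum : ∑ i, ((c θ i : ℝ) - c γ' i) * ⟪γ, α i⟫ = ⟪γ, θ⟫ := by
    simp only [sub_mul, Finset.sum_sub_distrib]
    rw [← h.inner_eq_sum γ hθ, ← h.inner_eq_sum γ hγ', horth, sub_zero]
  have hge := h.inner_nonneg_of_highest hhigh hj hγ hθ hγj hj
  have hz : ⟪γ, θ⟫ = 0 := le_antisymm (hsum ▸ Finset.sum_nonpos hterm) hge
  refine ⟨hz, fun i hi => ?_⟩
  have hi0 := (Finset.sum_eq_zero_iff_of_nonpos hterm).1 (hsum.trans hz) i (Finset.mem_univ i)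
  have hθi := hhigh _ (h.simple_mem i) i
  rw [h.coeff_simple, if_pos rfl] at hθi
  have : (c θ i : ℝ) ≠ 0 := by exact_mod_cast (by omega : c θ i ≠ 0)
  simpa [hi, this] using hi0

/-- Two roots with top `j`-th coefficient that are both antidominant away from `j` are not
orthogonal. -/
theorem inner_pos_of_antidominant (h : IsBasedRootSet R α c) {θ : V} (hθ : θ ∈ R)
    (hhigh : ∀ β ∈ R, ∀ i, c β i ≤ c θ i) {j : Fin n} (hj : 0 < c θ j) {γ γ' : V}
    (hγ : γ ∈ R) (hγ' : γ' ∈ R) (hγj : c γ j = c θ j) (hγ'j : c γ' j = c θ j)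
    (hanti : ∀ i, i ≠ j → ⟪γ, α i⟫ ≤ 0) (hanti' : ∀ i, i ≠ j → ⟪γ', α i⟫ ≤ 0) :
    0 < ⟪γ, γ'⟫ := by
  refine (h.inner_nonneg_of_highest hhigh hj hγ hγ' hγj (by omega)).lt_of_ne' fun horth => ?_
  obtain ⟨hγθ, hγα⟩ := h.orthogonal_highest hθ hhigh hj hγ hγ' hγj hγ'j hanti horth
  obtain ⟨hγ'θ, hγ'α⟩ := h.orthogonal_highest hθ hhigh hj hγ' hγ hγ'j hγj hanti'
    (by rwa [real_inner_comm])
  have hsupp : ∀ β ∈ R, c β j = c θ j → ⟪β, θ⟫ = 0 → ∀ i, c β i ≠ 0 → ⟪θ, α i⟫ = 0 := by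
    intro β hβ hβj hβθ i hi
    have hnn := h.coeff_nonneg_of_pos hβ (j := j) (by omega)
    rw [real_inner_comm, h.inner_eq_sum θ hβ] at hβθ
    have := (Finset.sum_eq_zero_iff_of_nonneg fun i _ => mul_nonneg
      (by exact_mod_cast hnn i) (h.inner_highest_nonneg hθ hhigh i)).1 hβθ i (Finset.mem_univ i)
    exact (mul_eq_zero.1 this).resolve_left (by exact_mod_cast hi)
  have hperp : ∀ β ∈ R, c β j = c θ j → ∀ i, c β i = 0 → ⟪β, α i⟫ = 0 →
      ∀ k, c β k ≠ 0 → ⟪α i, α k⟫ = 0 := by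
    intro β hβ hβj i hi hβi k hk
    have hnn := h.coeff_nonneg_of_pos hβ (j := j) (by omega)
    rw [real_inner_comm, h.inner_eq_sum _ hβ] at hβi
    have := (Finset.sum_eq_zero_iff_of_nonpos fun l _ => by
      by_cases hl : l = i
      · subst hl; simp [hi]
      · exact mul_nonpos_of_nonneg_of_nonpos (by exact_mod_cast hnn l)
          (h.inner_simple_nonpos (Ne.symm hl))).1 hβi k (Finset.mem_univ k)
    exact (mul_eq_zero.1 this).resolve_left (by exact_mod_cast hk)
  let P : Finset (Fin n) := Finset.univ.filter fun i => c γ i ≠ 0 ∨ c γ' i ≠ 0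
  have hP : ∀ i ∈ P, ⟪θ, α i⟫ = 0 := by
    intro i hi
    rcases (Finset.mem_filter.1 hi).2 with hi | hi
    · exact hsupp γ hγ hγj hγθ i hi
    · exact hsupp γ' hγ' hγ'j hγ'θ i hi
  have hPc : ∀ i ∈ Pᶜ, ∀ k ∈ P, ⟪α i, α k⟫ = 0 := by
    intro i hi k hk
    have hi : c γ i = 0 ∧ c γ' i = 0 := by simpa [P] using hi
    rcases (Finset.mem_filter.1 hk).2 with hk | hk
    · exact hperp γ hγ hγj i hi.1 (hγα i hi.2) k hk
    · exact hperp γ' hγ' hγ'j i hi.2 (hγ'α i hi.1) k hk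
  set x : V := ∑ i ∈ P, (c θ i : ℝ) • α i with hx
  have hθx : θ = x + ∑ i ∈ Pᶜ, (c θ i : ℝ) • α i := by
    rw [hx, Finset.sum_add_sum_compl]
    exact h.eq_sum θ hθ
  have h1 : ⟪θ, x⟫ = 0 := by
    rw [hx, inner_sum]
    exact Finset.sum_eq_zero fun i hi => by rw [real_inner_smul_right, hP i hi, mul_zero]
  have h2 : ⟪∑ i ∈ Pᶜ, (c θ i : ℝ) • α i, x⟫ = 0 := by
    rw [hx, sum_inner]
    refine Finset.sum_eq_zero fun i hi => ?_
    rw [inner_sum]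
    exact Finset.sum_eq_zero fun k hk => by
      rw [real_inner_smul_left, real_inner_smul_right, hPc i hi k hk, mul_zero, mul_zero]
  rw [hθx, inner_add_left, h2, add_zero, inner_self_eq_zero] at h1
  have h3 := linearIndependent_iff'.1 h.linearIndependent P _ (hx.symm.trans h1) j
    (by simp only [P, Finset.mem_filter, Finset.mem_univ, true_and]; omega)
  norm_cast at h3
  omega

/-- Among the roots with top `j`-th coefficient, only one admits no subtraction of a simple root
other than `α j`. -/
theorem eq_of_forall_sub_simple_notMem (h : IsBasedRootSet R α c) {θ : V} (hθ : θ ∈ R)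
    (hhigh : ∀ β ∈ R, ∀ i, c β i ≤ c θ i) {j : Fin n} (hj : 0 < c θ j) {γ γ' : V}
    (hγ : γ ∈ R) (hγ' : γ' ∈ R) (hγj : c γ j = c θ j) (hγ'j : c γ' j = c θ j)
    (hlow : ∀ i, i ≠ j → γ - α i ∉ R) (hlow' : ∀ i, i ≠ j → γ' - α i ∉ R) : γ = γ' := by
  by_contra hne
  have hp := h.inner_pos_of_antidominant hθ hhigh hj hγ hγ' hγj hγ'j
    (fun i hi => h.inner_simple_nonpos_of_sub_notMem hγ (by omega) hi (hlow i hi))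
    (fun i hi => h.inner_simple_nonpos_of_sub_notMem hγ' (by omega) hi (hlow' i hi))
  have hm := h.sub_mem γ hγ γ' hγ' hp hne
  have hm' := h.neg_mem _ hm
  have hco := h.coeff_sub hγ hγ' hm
  have hco' := h.coeff_neg hm
  rcases h.coeff_sign _ hm with hs | hs
  · obtain ⟨i, hi, hmem⟩ := h.exists_simple_sub_mem (j := j) hγ (by omega) (∑ i, c (γ - γ') i).toNat
      (γ - γ') hm hs (by rw [hco]; omega) (Int.self_le_toNat _) (by rwa [sub_sub_cancel])
    exact hlow i hi hmem
  · obtain ⟨i, hi, hmem⟩ := h.exists_simple_sub_mem (j := j) hγ' (by omega) (∑ i, c (-(γ - γ')) i).toNat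
      (-(γ - γ')) hm' (fun i => by rw [hco']; linarith [hs i]) (by rw [hco', hco]; omega)
      (Int.self_le_toNat _) (by rwa [show γ' - -(γ - γ') = γ by abel])
    exact hlow' i hi hmem

/-- Below every root with top `j`-th coefficient there is one that admits no subtraction of a
simple root other than `α j`. -/
theorem exists_le_forall_sub_simple_notMem (h : IsBasedRootSet R α c) (hfin : R.Finite)
    {j : Fin n} {β : V} (hβ : β ∈ R) :
    ∃ γ ∈ R, c γ j = c β j ∧ (∀ i, c γ i ≤ c β i) ∧ ∀ i, i ≠ j → γ - α i ∉ R := by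
  have hfinS : {γ ∈ R | c γ j = c β j ∧ ∀ i, c γ i ≤ c β i}.Finite := hfin.subset fun _ hx => hx.1
  obtain ⟨γ, ⟨hγ, hγj, hγle⟩, hmin⟩ := Set.exists_min_image _ (fun γ => ∑ i, c γ i) hfinS
    ⟨β, hβ, rfl, fun _ => le_rfl⟩
  refine ⟨γ, hγ, hγj, hγle, fun i hi hm => ?_⟩
  have hco := h.coeff_sub hγ (h.simple_mem i) hm
  simp only [h.coeff_simple] at hco
  have := hmin (γ - α i) ⟨hm, by rw [hco, if_neg hi.symm, sub_zero, hγj], fun k => by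
    rw [hco]
    have := hγle k
    split_ifs <;> omega⟩
  simp only [hco, Finset.sum_sub_distrib, Finset.sum_ite_eq', Finset.mem_univ, if_true] at this
  omega

/-- The roots with top `j`-th coefficient have a coordinatewise least element. -/
theorem exists_least (h : IsBasedRootSet R α c) (hfin : R.Finite) {θ : V} (hθ : θ ∈ R)
    (hhigh : ∀ β ∈ R, ∀ i, c β i ≤ c θ i) {j : Fin n} (hj : 0 < c θ j) :
    ∃ α₀ ∈ R, c α₀ j = c θ j ∧ ∀ β ∈ R, c β j = c θ j → ∀ i, c α₀ i ≤ c β i := by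
  obtain ⟨α₀, hα₀, hα₀j, -, hlow⟩ := h.exists_le_forall_sub_simple_notMem hfin (j := j) hθ
  refine ⟨α₀, hα₀, hα₀j, fun β hβ hβj => ?_⟩
  obtain ⟨γ, hγ, hγj, hle, hlow'⟩ := h.exists_le_forall_sub_simple_notMem hfin (j := j) hβ
  rwa [h.eq_of_forall_sub_simple_notMem hθ hhigh hj hα₀ hγ hα₀j (hγj.trans hβj) hlow hlow']

end IsBasedRootSet

/-- Expansion, in a family `v`, of a combination of the family obtained from `v` by replacing
`v j` with `∑ i, e i • v i`. -/
theorem sum_smul_replace {V : Type*} [AddCommGroup V] [Module ℝ V] {n : ℕ} (v : Fin n → V)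
    (e d : Fin n → ℝ) (j : Fin n) {w : V} (hw : w = ∑ i, e i • v i) :
    ∑ i, d i • (if i = j then w else v i) =
      ∑ i, ((if i = j then 0 else d i) + d j * e i) • v i := by
  have h1 : ∀ i, d i • (if i = j then w else v i) =
      (if i = j then 0 else d i) • v i + if i = j then d j • w else 0 := by
    intro i
    split_ifs with hi
    · simp [hi]
    · simp
  simp only [h1, Finset.sum_add_distrib, Finset.sum_ite_eq', Finset.mem_univ, if_true, add_smul,
    mul_smul, ← Finset.smul_sum, ← hw]

/-- The set {α ∈ R⁺ : c_j(α) = a_j} is nonempty with a unique element α₀ of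
minimal height; Δ₀ = {α_i : i ≠ j} ∪ {α₀} is linearly independent, every element of R₀ is an
integer combination of Δ₀ with coefficients all nonnegative or all nonpositive, and every
element of R₀ that is a nonnegative combination of Δ₀ lies in R⁺. -/
theorem statement1
    {V : Type*} [NormedAddCommGroup V] [InnerProductSpace ℝ V] [FiniteDimensional ℝ V]
    (R : Set V) (hRfin : R.Finite) (hR0 : (0 : V) ∉ R)
    (hRspan : Submodule.span ℝ R = ⊤)
    (hRneg : ∀ β ∈ R, -β ∈ R)
    (hRrefl : ∀ β ∈ R, ∀ γ ∈ R, γ - (2 * ⟪γ, β⟫ / ⟪β, β⟫) • β ∈ R)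
    (hRcrys : ∀ β ∈ R, ∀ γ ∈ R, ∃ k : ℤ, 2 * ⟪γ, β⟫ / ⟪β, β⟫ = (k : ℝ))
    (hRred : ∀ β ∈ R, ∀ s : ℝ, s • β ∈ R → s = 1 ∨ s = -1)
    (hRirr : ∀ R₁ R₂ : Set V, R = R₁ ∪ R₂ → (∀ a ∈ R₁, ∀ b ∈ R₂, ⟪a, b⟫ = 0) →
      R₁ = ∅ ∨ R₂ = ∅)
    (n : ℕ) (α : Fin n → V) (hα : ∀ i, α i ∈ R)
    (hαind : LinearIndependent ℝ α)
    (c : V → Fin n → ℤ)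
    (hc : ∀ β ∈ R, β = ∑ i, (c β i : ℝ) • α i)
    (hbase : ∀ β ∈ R, (∀ i, 0 ≤ c β i) ∨ (∀ i, c β i ≤ 0))
    (Rpos : Set V) (hRpos : Rpos = {β ∈ R | ∀ i, 0 ≤ c β i})
    (θ : V) (hθ : θ ∈ R) (hθhigh : ∀ β ∈ R, ∀ i, c β i ≤ c θ i)
    (j : Fin n) (haj : 2 ≤ c θ j)
    (R₀ : Set V)
    (hR₀ : R₀ = {β ∈ R | c β j = 0 ∨ c β j = c θ j ∨ c β j = -(c θ j)}) :
    ∃ α₀ ∈ Rpos, c α₀ j = c θ j ∧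
      (∀ β ∈ Rpos, c β j = c θ j → ∑ i, c α₀ i ≤ ∑ i, c β i) ∧
      (∀ β ∈ Rpos, c β j = c θ j →
        (∀ γ ∈ Rpos, c γ j = c θ j → ∑ i, c β i ≤ ∑ i, c γ i) → β = α₀) ∧
      LinearIndependent ℝ (fun i => if i = j then α₀ else α i) ∧
      (∀ β ∈ R₀, ∃ d : Fin n → ℤ, β = ∑ i, (d i : ℝ) • (if i = j then α₀ else α i) ∧
        ((∀ i, 0 ≤ d i) ∨ (∀ i, d i ≤ 0))) ∧
      (∀ β ∈ R₀, ∀ d : Fin n → ℤ, β = ∑ i, (d i : ℝ) • (if i = j then α₀ else α i) →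
        (∀ i, 0 ≤ d i) → β ∈ Rpos) := by
  have h : IsBasedRootSet R α c :=
    ⟨hR0, hRneg, fun β hβ γ hγ => root_sub_mem_of_inner_pos hR0 hRneg hRrefl hRcrys hRred hβ hγ,
      hα, hαind, hc, hbase⟩
  subst hRpos hR₀
  have hj : 0 < c θ j := by omega
  obtain ⟨α₀, hα₀, hα₀j, hleast⟩ := h.exists_least hRfin hθ hθhigh hj
  have hα₀pos := h.coeff_nonneg_of_pos hα₀ (j := j) (by omega)
  have hexp : ∀ d : Fin n → ℝ, ∑ i, d i • (if i = j then α₀ else α i) =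
      ∑ i, ((if i = j then 0 else d i) + d j * c α₀ i) • α i :=
    fun d => sum_smul_replace α _ d j (hc α₀ hα₀)
  have htop : ∀ β ∈ R, c β j = c θ j → ∃ d : Fin n → ℤ,
      β = ∑ i, (d i : ℝ) • (if i = j then α₀ else α i) ∧ ∀ i, 0 ≤ d i := by
    intro β hβ hβj
    refine ⟨fun i => if i = j then 1 else c β i - c α₀ i, ?_, fun i => ?_⟩
    · rw [hexp]
      conv_lhs => rw [hc β hβ]
      refine Finset.sum_congr rfl fun i _ => ?_
      by_cases hi : i = j
      · subst hi; simp [hβj, hα₀j]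
      · simp [hi]
    · have := hleast β hβ hβj i
      dsimp only
      split_ifs <;> omega
  refine ⟨α₀, ⟨hα₀, hα₀pos⟩, hα₀j, ?_, ?_, ?_, ?_, ?_⟩
  · exact fun β hβ hβj => Finset.sum_le_sum fun i _ => hleast β hβ.1 hβj i
  · intro β hβ hβj hmin
    have hle := hleast β hβ.1 hβj
    have heq := le_antisymm (Finset.sum_le_sum fun i _ => hle i) (hmin α₀ ⟨hα₀, hα₀pos⟩ hα₀j)
    have := (Finset.sum_eq_sum_iff_of_le fun i _ => hle i).1 heq
    exact h.eq_of_coeff_eq hβ.1 hα₀ fun i => (this i (Finset.mem_univ i)).symm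
  · rw [Fintype.linearIndependent_iff]
    intro g hg
    rw [hexp] at hg
    have hz := Fintype.linearIndependent_iff.1 hαind _ hg
    have hgj : g j = 0 := by
      have hzj := hz j
      simp only [if_true, zero_add, hα₀j] at hzj
      exact (mul_eq_zero.1 hzj).resolve_right (by exact_mod_cast hj.ne')
    intro i
    by_cases hi : i = j
    · rw [hi, hgj]
    · simpa [hi, hgj] using hz i
  · rintro β ⟨hβ, h0 | h1 | h2⟩
    · refine ⟨c β, ?_, hbase β hβ⟩
      rw [hexp]
      conv_lhs => rw [hc β hβ]
      refine Finset.sum_congr rfl fun i _ => ?_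
      by_cases hi : i = j
      · subst hi; simp [h0]
      · simp [hi, h0]
    · obtain ⟨d, hd, hpos⟩ := htop β hβ h1
      exact ⟨d, hd, Or.inl hpos⟩
    · obtain ⟨d, hd, hpos⟩ := htop (-β) (hRneg β hβ) (by rw [h.coeff_neg hβ, h2, neg_neg])
      refine ⟨fun i => -d i, ?_, Or.inr fun i => neg_nonpos.2 (hpos i)⟩
      rw [← neg_neg β, hd]
      simp only [Int.cast_neg, neg_smul, Finset.sum_neg_distrib]
  · intro β hβ d hd hpos
    refine ⟨hβ.1, fun i => ?_⟩
    rw [hexp] at hd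
    rw [h.coeff_eq hβ.1 (d := fun i => (if i = j then 0 else d i) + d j * c α₀ i)
      (by push_cast; exact hd) i]
    have h1 := mul_nonneg (hpos j) (hα₀pos i)
    have h2 := hpos i
    split_ifs <;> linarith
end

section
/- The root α_0 satisfies: (i) (α_0, α_0) = (θ, θ), i.e. α_0 is a long root; (ii) (α_0, α_i) ≤ 0 for every i ≠ j, and (α_0, α_j) > 0. -/
open RealInnerProductSpace

section Reflection

variable {V : Type*} [NormedAddCommGroup V] [InnerProductSpace ℝ V]

/-- Reflecting `v` in `w` negates its inner product with `w`. -/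
lemma inner_sub_two_mul_div_smul (v : V) {w : V} (hw : w ≠ 0) :
    ⟪v - (2 * ⟪v, w⟫ / ⟪w, w⟫) • w, w⟫ = -⟪v, w⟫ := by
  have : ⟪w, w⟫ ≠ 0 := inner_self_ne_zero.mpr hw
  rw [inner_sub_left, real_inner_smul_left]
  field_simp
  ring

/-- Reflecting `v` in `w` preserves the length of `v`. -/
lemma inner_self_sub_two_mul_div_smul (v : V) {w : V} (hw : w ≠ 0) :
    ⟪v - (2 * ⟪v, w⟫ / ⟪w, w⟫) • w, v - (2 * ⟪v, w⟫ / ⟪w, w⟫) • w⟫ = ⟪v, v⟫ := by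
  have h : ⟪w, w⟫ ≠ 0 := inner_self_ne_zero.mpr hw
  rw [inner_sub_right, real_inner_smul_right, inner_sub_two_mul_div_smul v hw, inner_sub_left,
    real_inner_smul_left, real_inner_comm v w]
  field_simp
  ring

/-- Reflecting twice in `w` is the identity. -/
lemma reflection_formula_involutive (v : V) {w : V} (hw : w ≠ 0) :
    (v - (2 * ⟪v, w⟫ / ⟪w, w⟫) • w) -
      (2 * ⟪v - (2 * ⟪v, w⟫ / ⟪w, w⟫) • w, w⟫ / ⟪w, w⟫) • w = v := by
  rw [inner_sub_two_mul_div_smul v hw]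
  module

end Reflection

section Coefficients

variable {V : Type*} [NormedAddCommGroup V] [InnerProductSpace ℝ V] {R : Set V}
  {n : ℕ} {α : Fin n → V} {c : V → Fin n → ℤ}

/-- Integer coordinates with respect to a linearly independent family are unique. -/
lemma coeff_eq_of_eq_sum (hαind : LinearIndependent ℝ α)
    (hc : ∀ β ∈ R, β = ∑ i, (c β i : ℝ) • α i)
    {β : V} (hβ : β ∈ R) {d : Fin n → ℤ} (h : β = ∑ i, (d i : ℝ) • α i) (i : Fin n) :
    c β i = d i := by
  have h0 : ∑ i, ((c β i : ℝ) - d i) • α i = 0 := by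
    simp only [sub_smul, Finset.sum_sub_distrib]
    rw [← hc β hβ, ← h, sub_self]
  have := Fintype.linearIndependent_iff.mp hαind _ h0 i
  exact_mod_cast sub_eq_zero.mp this

lemma coeff_sub_smul (hαind : LinearIndependent ℝ α)
    (hc : ∀ β ∈ R, β = ∑ i, (c β i : ℝ) • α i)
    {β γ : V} (hβ : β ∈ R) (hγ : γ ∈ R) {k : ℤ} (h : γ - (k : ℝ) • β ∈ R) (i : Fin n) :
    c (γ - (k : ℝ) • β) i = c γ i - k * c β i := by
  refine coeff_eq_of_eq_sum (d := fun i => c γ i - k * c β i) hαind hc h ?_ i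
  conv_lhs => rw [hc β hβ, hc γ hγ]
  simp only [Finset.smul_sum, ← Finset.sum_sub_distrib, smul_smul, ← sub_smul]
  push_cast
  rfl

lemma coeff_base (hαind : LinearIndependent ℝ α)
    (hc : ∀ β ∈ R, β = ∑ i, (c β i : ℝ) • α i) (hα : ∀ i, α i ∈ R) (i k : Fin n) :
    c (α i) k = if k = i then 1 else 0 := by
  refine coeff_eq_of_eq_sum (d := fun k => if k = i then 1 else 0) hαind hc (hα i) ?_ k
  simp

lemma inner_eq_sum_coeff (hc : ∀ β ∈ R, β = ∑ i, (c β i : ℝ) • α i)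
    {β : V} (hβ : β ∈ R) (v : V) : ⟪v, β⟫ = ∑ i, (c β i : ℝ) * ⟪v, α i⟫ := by
  conv_lhs => rw [hc β hβ]
  simp [inner_sum, real_inner_smul_right]

/-- Reflections in roots, together with their effect on coordinates and lengths. -/
lemma exists_int_reflection (hR0 : (0 : V) ∉ R)
    (hRrefl : ∀ β ∈ R, ∀ γ ∈ R, γ - (2 * ⟪γ, β⟫ / ⟪β, β⟫) • β ∈ R)
    (hRcrys : ∀ β ∈ R, ∀ γ ∈ R, ∃ k : ℤ, 2 * ⟪γ, β⟫ / ⟪β, β⟫ = (k : ℝ))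
    (hαind : LinearIndependent ℝ α)
    (hc : ∀ β ∈ R, β = ∑ i, (c β i : ℝ) • α i)
    {β γ : V} (hβ : β ∈ R) (hγ : γ ∈ R) :
    ∃ k : ℤ, 2 * ⟪γ, β⟫ / ⟪β, β⟫ = (k : ℝ) ∧ 2 * ⟪γ, β⟫ = k * ⟪β, β⟫ ∧
      γ - (k : ℝ) • β ∈ R ∧
      (∀ i, c (γ - (k : ℝ) • β) i = c γ i - k * c β i) ∧
      ⟪γ - (k : ℝ) • β, γ - (k : ℝ) • β⟫ = ⟪γ, γ⟫ := by
  have hβ0 : β ≠ 0 := fun h => hR0 (h ▸ hβ)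
  obtain ⟨k, hk⟩ := hRcrys β hβ γ hγ
  have hmem := hk ▸ hRrefl β hβ γ hγ
  refine ⟨k, hk, ?_, hmem, coeff_sub_smul hαind hc hβ hγ hmem, ?_⟩
  · rw [← hk, div_mul_cancel₀ _ (inner_self_ne_zero.mpr hβ0)]
  · rw [← hk]
    exact inner_self_sub_two_mul_div_smul γ hβ0

/-- The highest root has maximal length. -/
lemma inner_self_le_highest (hRfin : R.Finite) (hR0 : (0 : V) ∉ R)
    (hRrefl : ∀ β ∈ R, ∀ γ ∈ R, γ - (2 * ⟪γ, β⟫ / ⟪β, β⟫) • β ∈ R)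
    (hRcrys : ∀ β ∈ R, ∀ γ ∈ R, ∃ k : ℤ, 2 * ⟪γ, β⟫ / ⟪β, β⟫ = (k : ℝ))
    (hα : ∀ i, α i ∈ R) (hαind : LinearIndependent ℝ α)
    (hc : ∀ β ∈ R, β = ∑ i, (c β i : ℝ) • α i)
    {θ : V} (hθ : θ ∈ R) (hθhigh : ∀ β ∈ R, ∀ i, c β i ≤ c θ i) {β : V} (hβ : β ∈ R) :
    ⟪β, β⟫ ≤ ⟪θ, θ⟫ := by
  have hpos : ∀ i, 0 < ⟪α i, α i⟫ := fun i =>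
    real_inner_self_pos.mpr fun h => hR0 (h ▸ hα i)
  obtain ⟨μ, ⟨hμ, hμβ⟩, hμmax⟩ := Set.exists_max_image {μ ∈ R | ⟪μ, μ⟫ = ⟪β, β⟫}
    (fun μ => ∑ i, c μ i) (hRfin.subset fun _ h => h.1) ⟨β, hβ, rfl⟩
  have hμdom : ∀ i, 0 ≤ ⟪μ, α i⟫ := by
    intro i
    obtain ⟨k, -, hk, hmem, hcoef, hlen⟩ :=
      exists_int_reflection hR0 hRrefl hRcrys hαind hc (hα i) hμ
    have h := hμmax _ ⟨hmem, hlen.trans hμβ⟩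
    simp only [hcoef, coeff_base hαind hc hα] at h
    simp at h
    have : (0 : ℝ) ≤ k := by exact_mod_cast h
    nlinarith [mul_nonneg this (hpos i).le]
  have hθdom : ∀ i, 0 ≤ ⟪θ, α i⟫ := by
    intro i
    obtain ⟨k, -, hk, hmem, hcoef, -⟩ :=
      exists_int_reflection hR0 hRrefl hRcrys hαind hc (hα i) hθ
    have h := hθhigh _ hmem i
    simp only [hcoef, coeff_base hαind hc hα] at h
    simp at h
    have : (0 : ℝ) ≤ k := by exact_mod_cast h
    nlinarith [mul_nonneg this (hpos i).le]
  have key : ∀ v : V, (∀ i, 0 ≤ ⟪v, α i⟫) → ⟪v, μ⟫ ≤ ⟪v, θ⟫ := by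
    intro v hv
    rw [inner_eq_sum_coeff hc hμ, inner_eq_sum_coeff hc hθ]
    refine Finset.sum_le_sum fun i _ => mul_le_mul_of_nonneg_right ?_ (hv i)
    exact_mod_cast hθhigh μ hμ i
  rw [← hμβ]
  exact (key μ hμdom).trans ((real_inner_comm _ _).trans_le (key θ hθdom))

/-- Any root at a given positive level `c · j = c θ j` has positive inner product with some root
at that level having the same length as `θ`. -/
lemma exists_inner_pos_of_coeff_eq (hRfin : R.Finite) (hR0 : (0 : V) ∉ R)
    (hRrefl : ∀ β ∈ R, ∀ γ ∈ R, γ - (2 * ⟪γ, β⟫ / ⟪β, β⟫) • β ∈ R)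
    (hRcrys : ∀ β ∈ R, ∀ γ ∈ R, ∃ k : ℤ, 2 * ⟪γ, β⟫ / ⟪β, β⟫ = (k : ℝ))
    (hα : ∀ i, α i ∈ R) (hαind : LinearIndependent ℝ α)
    (hc : ∀ β ∈ R, β = ∑ i, (c β i : ℝ) • α i)
    {θ : V} (hθ : θ ∈ R) {j : Fin n} (hθj : 0 < c θ j)
    {δ : V} (hδ : δ ∈ R) (hδj : c δ j = c θ j) :
    ∃ β ∈ R, c β j = c θ j ∧ ⟪β, β⟫ = ⟪θ, θ⟫ ∧ 0 < ⟪β, δ⟫ := by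
  have hfin : {β ∈ R | c β j = c θ j ∧ ⟪β, β⟫ = ⟪θ, θ⟫}.Finite := hRfin.subset fun _ h => h.1
  set T := hfin.toFinset
  have hT : ∀ v, v ∈ T ↔ v ∈ R ∧ c v j = c θ j ∧ ⟪v, v⟫ = ⟪θ, θ⟫ :=
    fun _ => hfin.mem_toFinset
  by_contra! hcon
  set M := ∑ v ∈ T, v
  have horth : ∀ i, i ≠ j → ⟪M, α i⟫ = 0 := by
    intro i hij
    have hi0 : α i ≠ 0 := fun h => hR0 (h ▸ hα i)
    rw [sum_inner]
    refine Finset.sum_involution (fun v _ => v - (2 * ⟪v, α i⟫ / ⟪α i, α i⟫) • α i)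
      ?_ ?_ ?_ ?_
    · intro v _
      rw [inner_sub_two_mul_div_smul v hi0, add_neg_cancel]
    · intro v _ hne heq
      have h := inner_sub_two_mul_div_smul v hi0
      rw [heq] at h
      exact hne (by linarith)
    · intro v hv
      obtain ⟨hvR, hvj, hvθ⟩ := (hT v).mp hv
      obtain ⟨k, hk, -, hmem, hcoef, hlen⟩ :=
        exists_int_reflection hR0 hRrefl hRcrys hαind hc (hα i) hvR
      rw [hk, hT]
      refine ⟨hmem, ?_, hlen.trans hvθ⟩
      rw [hcoef, coeff_base hαind hc hα, if_neg hij.symm, hvj, mul_zero, sub_zero]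
    · intro v _
      exact reflection_formula_involutive v hi0
  have hlevel : ∀ v ∈ R, c v j = c θ j → ⟪M, v⟫ = c θ j * ⟪M, α j⟫ := by
    intro v hv hvj
    rw [inner_eq_sum_coeff hc hv, Finset.sum_eq_single j, hvj]
    · intro i _ hij
      rw [horth i hij, mul_zero]
    · simp
  have hMδ : ⟪M, δ⟫ ≤ 0 := by
    rw [sum_inner]
    refine Finset.sum_nonpos fun v hv => ?_
    obtain ⟨hvR, hvj, hvθ⟩ := (hT v).mp hv
    exact hcon v hvR hvj hvθ
  have hMM : ⟪M, M⟫ ≤ 0 := by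
    have : ⟪M, M⟫ = ∑ v ∈ T, ⟪M, v⟫ := inner_sum T id M
    rw [this]
    refine Finset.sum_nonpos fun v hv => ?_
    obtain ⟨hvR, hvj, -⟩ := (hT v).mp hv
    rwa [hlevel v hvR hvj, ← hlevel δ hδ hδj]
  have hM0 : M = 0 := real_inner_self_nonpos.mp hMM
  have hsum : ∑ i, (∑ v ∈ T, (c v i : ℝ)) • α i = 0 := by
    simp only [Finset.sum_smul]
    rw [Finset.sum_comm, ← hM0]
    exact Finset.sum_congr rfl fun v hv => (hc v ((hT v).mp hv).1).symm
  have hj := Fintype.linearIndependent_iff.mp hαind _ hsum j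
  have hjpos : 0 < ∑ v ∈ T, (c v j : ℝ) := by
    refine Finset.sum_pos (fun v hv => ?_) ⟨θ, (hT θ).mpr ⟨hθ, rfl, rfl⟩⟩
    rw [((hT v).mp hv).2.1]
    exact_mod_cast hθj
  exact hjpos.ne' hj

/-- If two roots have positive inner product and `β` is at least as long as `γ ≠ β`, then
`γ - β` is a root. -/
lemma sub_mem_of_inner_pos (hR0 : (0 : V) ∉ R)
    (hRrefl : ∀ β ∈ R, ∀ γ ∈ R, γ - (2 * ⟪γ, β⟫ / ⟪β, β⟫) • β ∈ R)
    (hRcrys : ∀ β ∈ R, ∀ γ ∈ R, ∃ k : ℤ, 2 * ⟪γ, β⟫ / ⟪β, β⟫ = (k : ℝ))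
    {β γ : V} (hβ : β ∈ R) (hγ : γ ∈ R) (hne : γ ≠ β)
    (hle : ⟪γ, γ⟫ ≤ ⟪β, β⟫) (hpos : 0 < ⟪γ, β⟫) : γ - β ∈ R := by
  have hββ : 0 < ⟪β, β⟫ := real_inner_self_pos.mpr fun h => hR0 (h ▸ hβ)
  obtain ⟨k, hk⟩ := hRcrys β hβ γ hγ
  have hmem := hk ▸ hRrefl β hβ γ hγ
  have hk' : 2 * ⟪γ, β⟫ = k * ⟪β, β⟫ := by rw [← hk, div_mul_cancel₀ _ hββ.ne']
  have hk0 : 0 < k := by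
    have : (0 : ℝ) < k := by rw [← hk]; positivity
    exact_mod_cast this
  have hk2 : k < 2 := by
    by_contra! h2
    have h2' : (2 : ℝ) ≤ k := by exact_mod_cast h2
    have hsub : 0 < ⟪γ - β, γ - β⟫ := real_inner_self_pos.mpr (sub_ne_zero.mpr hne)
    rw [real_inner_sub_sub_self] at hsub
    nlinarith [mul_le_mul_of_nonneg_right h2' hββ.le]
  obtain rfl : k = 1 := by omega
  simpa using hmem

end Coefficients

/-- The root α₀ (the element of minimal height of
{α ∈ R⁺ : c_j(α) = a_j}) is long, (α₀, α_i) ≤ 0 for i ≠ j, and (α₀, α_j) > 0. -/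
theorem statement2
    {V : Type*} [NormedAddCommGroup V] [InnerProductSpace ℝ V] [FiniteDimensional ℝ V]
    (R : Set V) (hRfin : R.Finite) (hR0 : (0 : V) ∉ R)
    (hRspan : Submodule.span ℝ R = ⊤)
    (hRneg : ∀ β ∈ R, -β ∈ R)
    (hRrefl : ∀ β ∈ R, ∀ γ ∈ R, γ - (2 * ⟪γ, β⟫ / ⟪β, β⟫) • β ∈ R)
    (hRcrys : ∀ β ∈ R, ∀ γ ∈ R, ∃ k : ℤ, 2 * ⟪γ, β⟫ / ⟪β, β⟫ = (k : ℝ))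
    (hRred : ∀ β ∈ R, ∀ s : ℝ, s • β ∈ R → s = 1 ∨ s = -1)
    (hRirr : ∀ R₁ R₂ : Set V, R = R₁ ∪ R₂ → (∀ a ∈ R₁, ∀ b ∈ R₂, ⟪a, b⟫ = 0) →
      R₁ = ∅ ∨ R₂ = ∅)
    (n : ℕ) (α : Fin n → V) (hα : ∀ i, α i ∈ R)
    (hαind : LinearIndependent ℝ α)
    (c : V → Fin n → ℤ)
    (hc : ∀ β ∈ R, β = ∑ i, (c β i : ℝ) • α i)
    (hbase : ∀ β ∈ R, (∀ i, 0 ≤ c β i) ∨ (∀ i, c β i ≤ 0))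
    (Rpos : Set V) (hRpos : Rpos = {β ∈ R | ∀ i, 0 ≤ c β i})
    (θ : V) (hθ : θ ∈ R) (hθhigh : ∀ β ∈ R, ∀ i, c β i ≤ c θ i)
    (j : Fin n) (haj : 2 ≤ c θ j)
    (α₀ : V) (hα₀pos : α₀ ∈ Rpos) (hα₀j : c α₀ j = c θ j)
    (hα₀min : ∀ β ∈ Rpos, c β j = c θ j → ∑ i, c α₀ i ≤ ∑ i, c β i) :
    ⟪α₀, α₀⟫ = ⟪θ, θ⟫ ∧
    (∀ i, i ≠ j → ⟪α₀, α i⟫ ≤ 0) ∧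
    0 < ⟪α₀, α j⟫ := by
  subst hRpos
  obtain ⟨hα₀, hα₀nonneg⟩ := hα₀pos
  have hmin : ∀ β ∈ R, c β j = c θ j → ∑ i, c α₀ i ≤ ∑ i, c β i := by
    intro β hβ hβj
    refine hα₀min β ⟨hβ, (hbase β hβ).resolve_right fun h => ?_⟩ hβj
    have := h j
    omega
  have hanti : ∀ i, i ≠ j → ⟪α₀, α i⟫ ≤ 0 := by
    intro i hij
    obtain ⟨k, -, hk, hmem, hcoef, -⟩ :=
      exists_int_reflection hR0 hRrefl hRcrys hαind hc (hα i) hα₀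
    have h := hmin _ hmem (by
      rw [hcoef, coeff_base hαind hc hα, if_neg hij.symm, hα₀j, mul_zero, sub_zero])
    simp only [hcoef, coeff_base hαind hc hα] at h
    simp at h
    have hk0 : (k : ℝ) ≤ 0 := by exact_mod_cast h
    nlinarith [mul_nonneg (neg_nonneg.mpr hk0) (real_inner_self_nonneg (x := α i))]
  refine ⟨?_, hanti, ?_⟩
  · have hlong : ∀ β ∈ R, ⟪β, β⟫ ≤ ⟪θ, θ⟫ := fun β hβ =>
      inner_self_le_highest hRfin hR0 hRrefl hRcrys hα hαind hc hθ hθhigh hβ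
    obtain ⟨β, hβ, hβj, hββ, hβpos⟩ := exists_inner_pos_of_coeff_eq hRfin hR0 hRrefl hRcrys hα
      hαind hc hθ (by omega) hα₀ hα₀j
    by_cases hne : α₀ = β
    · rw [hne, hββ]
    have hneg := sub_mem_of_inner_pos hR0 hRrefl hRcrys hβ hα₀ hne
      (hββ ▸ hlong α₀ hα₀) (by rwa [real_inner_comm])
    have hγ : β - α₀ ∈ R := by simpa using hRneg _ hneg
    have hγ0 : 0 < ⟪β - α₀, β - α₀⟫ := real_inner_self_pos.mpr (sub_ne_zero.mpr (Ne.symm hne))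
    have hγc : ∀ i, c (β - α₀) i = c β i - c α₀ i := by
      intro i
      simpa using coeff_sub_smul (k := 1) hαind hc hα₀ hβ (by simpa using hγ) i
    have hγsum : 0 < ∑ i, c (β - α₀) i := by
      have hnonneg : 0 ≤ ∑ i, c (β - α₀) i := by
        simp only [hγc, Finset.sum_sub_distrib]
        linarith [hmin β hβ hβj]
      refine hnonneg.lt_of_ne fun h0 => ?_
      have hzero : ∀ i, c (β - α₀) i = 0 := by
        intro i
        rcases hbase _ hγ with h | h
        · exact (Finset.sum_eq_zero_iff_of_nonneg fun i _ => h i).mp h0.symm i (Finset.mem_univ i)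
        · exact (Finset.sum_eq_zero_iff_of_nonpos fun i _ => h i).mp h0.symm i (Finset.mem_univ i)
      have := hc _ hγ
      simp only [hzero, Int.cast_zero, zero_smul, Finset.sum_const_zero] at this
      exact hR0 (this ▸ hγ)
    obtain ⟨k, -, hk, hmem, hcoef, hlen⟩ :=
      exists_int_reflection hR0 hRrefl hRcrys hαind hc hγ hβ
    have hheight := hmin _ hmem (by rw [hcoef, hγc, hβj, hα₀j, sub_self, mul_zero, sub_zero])
    simp only [hcoef, Finset.sum_sub_distrib, ← Finset.mul_sum] at hheight
    have hk1 : k ≤ 1 := by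
      have hs : ∑ i, c (β - α₀) i = ∑ i, c β i - ∑ i, c α₀ i := by
        simp only [hγc, Finset.sum_sub_distrib]
      nlinarith
    have hk0 : 0 < k := by
      by_contra! h
      have h' : (k : ℝ) ≤ 0 := by exact_mod_cast h
      have hle := hββ ▸ hlong α₀ hα₀
      have hexp : ⟪α₀, α₀⟫ = ⟪β, β⟫ - 2 * ⟪β, β - α₀⟫ + ⟪β - α₀, β - α₀⟫ := by
        rw [real_inner_sub_sub_self, inner_sub_right]
        ring
      nlinarith [mul_nonneg (neg_nonneg.mpr h') hγ0.le]
    obtain rfl : k = 1 := by omega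
    rw [← hββ, ← hlen]
    simp
  · have hα₀α₀ : 0 < ⟪α₀, α₀⟫ := real_inner_self_pos.mpr fun h => hR0 (h ▸ hα₀)
    rw [inner_eq_sum_coeff hc hα₀, ← Finset.add_sum_erase _ _ (Finset.mem_univ j)] at hα₀α₀
    have hrest : ∑ i ∈ Finset.univ.erase j, (c α₀ i : ℝ) * ⟪α₀, α i⟫ ≤ 0 :=
      Finset.sum_nonpos fun i hi => mul_nonpos_of_nonneg_of_nonpos
        (by exact_mod_cast hα₀nonneg i) (hanti i (Finset.ne_of_mem_erase hi))
    have hj : (0 : ℝ) ≤ c α₀ j := by exact_mod_cast hα₀nonneg j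
    exact pos_of_mul_pos_right (by linarith) hj
end

section
/- For each k with 1 ≤ k ≤ a_j − 1, the set {α ∈ R^+ : c_j(α) = k} is nonempty and contains a unique element θ_k of maximal height. Moreover θ_k satisfies: (θ_k, α_i) ≥ 0 and θ_k + α_i ∉ R for every i ≠ j; (θ_k, α_0) ≥ 0 and θ_k + α_0 ∉ R; θ_k + α_j ∈ R; c_i(θ_k) ≥ 1 for every i ∈ {1, …, n}; and θ − θ_k ∈ R^+ with c_j(θ − θ_k) = a_j − k. -/
open RealInnerProductSpace

section Obtuse

variable {V ι : Type*} [NormedAddCommGroup V] [InnerProductSpace ℝ V] [Fintype ι]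

lemma exists_pos_coeff_inner_pos {b : ι → V} {x : ι → ℝ} (hx : ∀ i, 0 ≤ x i)
    (hv : ∑ i, x i • b i ≠ 0) : ∃ i, 0 < x i ∧ 0 < ⟪∑ i, x i • b i, b i⟫ := by
  by_contra! hcon
  have hself : 0 < ⟪∑ i, x i • b i, ∑ i, x i • b i⟫ := real_inner_self_pos.2 hv
  rw [inner_sum] at hself
  refine hself.not_ge (Finset.sum_nonpos fun i _ => ?_)
  rw [real_inner_smul_right]
  rcases (hx i).eq_or_lt with h | h
  · simp [← h]
  · exact mul_nonpos_of_nonneg_of_nonpos (hx i) (hcon i h)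

/-- A vector pairing nonnegatively with an obtuse basis has nonnegative coordinates. -/
lemma coeff_nonneg_of_obtuse {b : ι → V} (hb : LinearIndependent ℝ b)
    (hobt : ∀ i l, i ≠ l → ⟪b i, b l⟫ ≤ 0) {x : ι → ℝ}
    (hdom : ∀ i, 0 ≤ ⟪∑ i, x i • b i, b i⟫) (i : ι) : 0 ≤ x i := by
  have hneg : ∑ i, (x i)⁻ • b i = 0 := by
    rw [← real_inner_self_nonpos]
    have h1 : 0 ≤ ⟪∑ i, x i • b i, ∑ i, (x i)⁻ • b i⟫ := by
      rw [inner_sum]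
      refine Finset.sum_nonneg fun l _ => ?_
      rw [real_inner_smul_right]
      exact mul_nonneg (negPart_nonneg _) (hdom l)
    have h2 : ⟪∑ i, (x i)⁺ • b i, ∑ i, (x i)⁻ • b i⟫ ≤ 0 := by
      simp only [inner_sum, sum_inner, real_inner_smul_right, real_inner_smul_left]
      refine Finset.sum_nonpos fun l _ => Finset.sum_nonpos fun m _ => ?_
      rcases eq_or_ne m l with rfl | hml
      · rcases le_total 0 (x m) with h | h
        · simp [negPart_eq_zero.2 h]
        · simp [posPart_eq_zero.2 h]
      · exact mul_nonpos_of_nonneg_of_nonpos (negPart_nonneg _)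
          (mul_nonpos_of_nonneg_of_nonpos (posPart_nonneg _) (hobt _ _ hml))
    have h3 : ∑ i, x i • b i = ∑ i, (x i)⁺ • b i - ∑ i, (x i)⁻ • b i := by
      simp only [← Finset.sum_sub_distrib, ← sub_smul, posPart_sub_negPart]
    rw [h3, inner_sub_left] at h1
    linarith
  exact negPart_eq_zero.1 (Fintype.linearIndependent_iff.1 hb _ hneg i)

/-- Two vectors pairing nonnegatively with an obtuse basis, and with a common positive
coordinate, have positive inner product. -/
lemma inner_pos_of_obtuse {b : ι → V} (hb : LinearIndependent ℝ b)
    (hobt : ∀ i l, i ≠ l → ⟪b i, b l⟫ ≤ 0) {x y : ι → ℝ}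
    (hx : ∀ i, 0 ≤ ⟪∑ i, x i • b i, b i⟫) (hy : ∀ i, 0 ≤ ⟪∑ i, y i • b i, b i⟫)
    {j : ι} (hxj : 0 < x j) (hyj : 0 < y j) :
    0 < ⟪∑ i, x i • b i, ∑ i, y i • b i⟫ := by
  classical
  have hx0 := coeff_nonneg_of_obtuse hb hobt hx
  have hy0 := coeff_nonneg_of_obtuse hb hobt hy
  have hterm : ∀ i, 0 ≤ y i * ⟪∑ i, x i • b i, b i⟫ := fun i => mul_nonneg (hy0 i) (hx i)
  have hterm' : ∀ i, 0 ≤ x i * ⟪∑ i, y i • b i, b i⟫ := fun i => mul_nonneg (hx0 i) (hy i)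
  have hexp : ⟪∑ i, x i • b i, ∑ i, y i • b i⟫ = ∑ i, y i * ⟪∑ i, x i • b i, b i⟫ := by
    rw [inner_sum]; simp only [real_inner_smul_right]
  have hexp' : ⟪∑ i, x i • b i, ∑ i, y i • b i⟫ = ∑ i, x i * ⟪∑ i, y i • b i, b i⟫ := by
    rw [real_inner_comm, inner_sum]; simp only [real_inner_smul_right]
  by_contra hcon
  have hzero : ⟪∑ i, x i • b i, ∑ i, y i • b i⟫ = 0 :=
    le_antisymm (not_lt.1 hcon) (hexp ▸ Finset.sum_nonneg fun i _ => hterm i)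
  have horth : ∀ i, y i ≠ 0 → ⟪∑ i, x i • b i, b i⟫ = 0 := fun i hi =>
    (mul_eq_zero.1 ((Finset.sum_eq_zero_iff_of_nonneg fun i _ => hterm i).1
      (hexp ▸ hzero) i (Finset.mem_univ _))).resolve_left hi
  have horth' : ∀ i, x i ≠ 0 → ⟪∑ i, y i • b i, b i⟫ = 0 := fun i hi =>
    (mul_eq_zero.1 ((Finset.sum_eq_zero_iff_of_nonneg fun i _ => hterm' i).1
      (hexp' ▸ hzero) i (Finset.mem_univ _))).resolve_left hi
  have hsep : ∀ i l, x i ≠ 0 → y i = 0 → y l ≠ 0 → ⟪b i, b l⟫ = 0 := by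
    intro i l hxi hyi hyl
    have h0 := horth' i hxi
    simp only [sum_inner, real_inner_smul_left] at h0
    have hle : ∀ m ∈ Finset.univ, y m * ⟪b m, b i⟫ ≤ 0 := by
      intro m _
      rcases eq_or_ne m i with rfl | hmi
      · simp [hyi]
      · exact mul_nonpos_of_nonneg_of_nonpos (hy0 m) (hobt m i hmi)
    have := (Finset.sum_eq_zero_iff_of_nonpos hle).1 h0 l (Finset.mem_univ _)
    rw [real_inner_comm]
    exact (mul_eq_zero.1 this).resolve_left hyl
  let z : ι → ℝ := fun i => if y i = 0 then 0 else x i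
  have hz : ∑ i, z i • b i = 0 := by
    rw [← inner_self_eq_zero (𝕜 := ℝ)]
    rw [inner_sum]
    refine Finset.sum_eq_zero fun l _ => ?_
    rw [real_inner_smul_right]
    by_cases hyl : y l = 0
    · simp [z, hyl]
    · suffices ⟪∑ i, z i • b i, b l⟫ = ⟪∑ i, x i • b i, b l⟫ by rw [this, horth l hyl, mul_zero]
      simp only [sum_inner, real_inner_smul_left]
      refine Finset.sum_congr rfl fun i _ => ?_
      by_cases hyi : y i = 0
      · by_cases hxi : x i = 0
        · simp [z, hxi]
        · simp [hsep i l hxi hyi hyl]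
      · simp [z, hyi]
  have := Fintype.linearIndependent_iff.1 hb z hz j
  simp only [z, hyj.ne', if_false] at this
  exact hxj.ne' this

end Obtuse

/-- A crystallographic root system `R` with base `α` and coordinate function `c`. -/
structure IsBasedRootSystem {V ι : Type*} [NormedAddCommGroup V] [InnerProductSpace ℝ V]
    [Fintype ι] (R : Set V) (α : ι → V) (c : V → ι → ℤ) : Prop where
  zero_notMem : (0 : V) ∉ R
  neg_mem : ∀ β ∈ R, -β ∈ R
  refl_mem : ∀ β ∈ R, ∀ γ ∈ R, γ - (2 * ⟪γ, β⟫ / ⟪β, β⟫) • β ∈ R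
  crystallographic : ∀ β ∈ R, ∀ γ ∈ R, ∃ k : ℤ, 2 * ⟪γ, β⟫ / ⟪β, β⟫ = (k : ℝ)
  base_mem : ∀ i, α i ∈ R
  linearIndependent : LinearIndependent ℝ α
  eq_sum : ∀ β ∈ R, β = ∑ i, (c β i : ℝ) • α i
  sign : ∀ β ∈ R, (∀ i, 0 ≤ c β i) ∨ (∀ i, c β i ≤ 0)

namespace IsBasedRootSystem

variable {V ι : Type*} [NormedAddCommGroup V] [InnerProductSpace ℝ V] [Fintype ι]
  {R : Set V} {α : ι → V} {c : V → ι → ℤ}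

lemma coeff_eq (h : IsBasedRootSystem R α c) {β : V} (hβ : β ∈ R) {z : ι → ℤ}
    (hz : β = ∑ i, (z i : ℝ) • α i) (i : ι) : c β i = z i := by
  have h0 : ∑ i, ((c β i : ℝ) - z i) • α i = 0 := by
    simp only [sub_smul, Finset.sum_sub_distrib]
    rw [← h.eq_sum β hβ, ← hz, sub_self]
  have := Fintype.linearIndependent_iff.1 h.linearIndependent _ h0 i
  exact_mod_cast sub_eq_zero.1 this

lemma coeff_add (h : IsBasedRootSystem R α c) {β γ : V} (hβ : β ∈ R) (hγ : γ ∈ R)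
    (hs : β + γ ∈ R) (i : ι) : c (β + γ) i = c β i + c γ i := by
  refine h.coeff_eq hs (z := fun i => c β i + c γ i) ?_ i
  push_cast
  simp only [add_smul, Finset.sum_add_distrib]
  rw [← h.eq_sum β hβ, ← h.eq_sum γ hγ]

lemma coeff_sub (h : IsBasedRootSystem R α c) {β γ : V} (hβ : β ∈ R) (hγ : γ ∈ R)
    (hs : β - γ ∈ R) (i : ι) : c (β - γ) i = c β i - c γ i := by
  refine h.coeff_eq hs (z := fun i => c β i - c γ i) ?_ i
  push_cast
  simp only [sub_smul, Finset.sum_sub_distrib]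
  rw [← h.eq_sum β hβ, ← h.eq_sum γ hγ]

lemma coeff_neg (h : IsBasedRootSystem R α c) {β : V} (hβ : β ∈ R) (i : ι) :
    c (-β) i = -c β i := by
  refine h.coeff_eq (h.neg_mem β hβ) (z := fun i => -c β i) ?_ i
  push_cast
  simp only [neg_smul, Finset.sum_neg_distrib]
  rw [← h.eq_sum β hβ]

lemma coeff_base [DecidableEq ι] (h : IsBasedRootSystem R α c) (i l : ι) :
    c (α i) l = if l = i then 1 else 0 := by
  refine h.coeff_eq (h.base_mem i) (z := fun l => if l = i then 1 else 0) ?_ l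
  simp

lemma coeff_base_self (h : IsBasedRootSystem R α c) (i : ι) : c (α i) i = 1 := by
  classical simp [h.coeff_base]

lemma coeff_base_of_ne (h : IsBasedRootSystem R α c) {i l : ι} (hil : l ≠ i) :
    c (α i) l = 0 := by
  classical simp [h.coeff_base, hil]

lemma sum_coeff_base (h : IsBasedRootSystem R α c) (i : ι) : ∑ l, c (α i) l = 1 := by
  classical simp [h.coeff_base]

lemma nonneg_of_coeff_pos (h : IsBasedRootSystem R α c) {β : V} (hβ : β ∈ R) {j : ι}
    (hj : 0 < c β j) (i : ι) : 0 ≤ c β i :=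
  (h.sign β hβ).resolve_right (fun hn => hj.not_ge (hn j)) i

lemma add_mem_of_inner_neg (h : IsBasedRootSystem R α c) {β γ : V} (hβ : β ∈ R) (hγ : γ ∈ R)
    (hne : β ≠ -γ) (hlt : ⟪β, γ⟫ < 0) : β + γ ∈ R := by
  have hβ0 : 0 < ⟪β, β⟫ := real_inner_self_pos.2 fun h0 => h.zero_notMem (h0 ▸ hβ)
  have hγ0 : 0 < ⟪γ, γ⟫ := real_inner_self_pos.2 fun h0 => h.zero_notMem (h0 ▸ hγ)
  obtain ⟨p, hp⟩ := h.crystallographic γ hγ β hβ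
  obtain ⟨q, hq⟩ := h.crystallographic β hβ γ hγ
  have hrp := h.refl_mem γ hγ β hβ
  have hrq := h.refl_mem β hβ γ hγ
  rw [hp] at hrp
  rw [hq] at hrq
  rw [div_eq_iff hγ0.ne'] at hp
  rw [div_eq_iff hβ0.ne', real_inner_comm] at hq
  have hp0 : p < 0 := by
    by_contra! hcon
    have : (0 : ℝ) ≤ p := by exact_mod_cast hcon
    nlinarith [mul_nonneg this hγ0.le]
  have hq0 : q < 0 := by
    by_contra! hcon
    have : (0 : ℝ) ≤ q := by exact_mod_cast hcon
    nlinarith [mul_nonneg this hβ0.le]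
  rcases eq_or_ne p (-1) with rfl | hp1
  · simpa using hrp
  rcases eq_or_ne q (-1) with rfl | hq1
  · simpa [add_comm] using hrq
  have hp2 : (p : ℝ) ≤ -2 := by
    have : p ≤ -2 := by lia
    exact_mod_cast this
  have hq2 : (q : ℝ) ≤ -2 := by
    have : q ≤ -2 := by lia
    exact_mod_cast this
  refine absurd ?_ hne
  rw [← add_eq_zero_iff_eq_neg, ← real_inner_self_nonpos]
  have hexp : ⟪β + γ, β + γ⟫ = ⟪β, β⟫ + 2 * ⟪β, γ⟫ + ⟪γ, γ⟫ := by
    rw [inner_add_left, inner_add_right, inner_add_right, real_inner_comm β γ]; ring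
  rw [hexp]
  nlinarith

lemma sub_mem_of_inner_pos (h : IsBasedRootSystem R α c) {β γ : V} (hβ : β ∈ R) (hγ : γ ∈ R)
    (hne : β ≠ γ) (hlt : 0 < ⟪β, γ⟫) : β - γ ∈ R := by
  rw [sub_eq_add_neg]
  exact h.add_mem_of_inner_neg hβ (h.neg_mem γ hγ) (by simpa using hne) (by simpa using hlt)

lemma inner_nonneg_of_add_notMem (h : IsBasedRootSystem R α c) {β γ : V} (hβ : β ∈ R)
    (hγ : γ ∈ R) (hne : β ≠ -γ) (hs : β + γ ∉ R) : 0 ≤ ⟪β, γ⟫ := by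
  by_contra! hcon
  exact hs (h.add_mem_of_inner_neg hβ hγ hne hcon)

lemma ne_neg_of_coeff (h : IsBasedRootSystem R α c) {β γ : V} (hγ : γ ∈ R) {j : ι}
    (hβj : 0 < c β j) (hγj : 0 ≤ c γ j) : β ≠ -γ := by
  rintro rfl
  have := h.coeff_neg hγ j
  lia

lemma inner_base_nonpos (h : IsBasedRootSystem R α c) {i l : ι} (hil : i ≠ l) :
    ⟪α i, α l⟫ ≤ 0 := by
  by_contra! hcon
  have hm := h.sub_mem_of_inner_pos (h.base_mem i) (h.base_mem l)
    (h.linearIndependent.injective.ne hil) hcon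
  have h1 := h.coeff_sub (h.base_mem i) (h.base_mem l) hm i
  have h2 := h.coeff_sub (h.base_mem i) (h.base_mem l) hm l
  rw [h.coeff_base_self, h.coeff_base_of_ne hil] at h1
  rw [h.coeff_base_self, h.coeff_base_of_ne hil.symm] at h2
  have := h.nonneg_of_coeff_pos hm (j := i) (by lia) l
  lia

/-- If `γ < β` are roots and `γ` is not negative, one can add a simple root to `γ`. -/
lemma exists_add_base_mem (h : IsBasedRootSystem R α c) {β γ : V} (hβ : β ∈ R) (hγ : γ ∈ R)
    (hne : β ≠ γ) (hle : ∀ i, c γ i ≤ c β i) {j : ι} (hj : 0 < c γ j) :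
    ∃ i, c γ i < c β i ∧ γ + α i ∈ R := by
  obtain ⟨N, hN⟩ : ∃ N : ℕ, ∑ i, (c β i - c γ i) ≤ N := ⟨_, Int.self_le_toNat _⟩
  induction N generalizing β with
  | zero =>
    refine absurd ?_ hne
    have h0 : ∀ i, c β i - c γ i = 0 := fun i =>
      (Finset.sum_eq_zero_iff_of_nonneg fun i _ => sub_nonneg.2 (hle i)).1
        (le_antisymm (by simpa using hN) (Finset.sum_nonneg fun i _ => sub_nonneg.2 (hle i)))
        i (Finset.mem_univ _)
    rw [h.eq_sum β hβ, h.eq_sum γ hγ]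
    refine Finset.sum_congr rfl fun i _ => ?_
    rw [sub_eq_zero.1 (h0 i)]
  | succ N ih =>
    have hδ : ∑ i, ((c β i : ℝ) - c γ i) • α i = β - γ := by
      simp only [sub_smul, Finset.sum_sub_distrib]
      rw [← h.eq_sum β hβ, ← h.eq_sum γ hγ]
    obtain ⟨i, hi, hpos⟩ := exists_pos_coeff_inner_pos (b := α)
      (x := fun i => (c β i : ℝ) - c γ i)
      (fun i => sub_nonneg.2 (by exact_mod_cast hle i)) (hδ ▸ sub_ne_zero.2 hne)
    have hi : c γ i < c β i := by exact_mod_cast sub_pos.1 hi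
    rw [hδ, inner_sub_left] at hpos
    rcases lt_or_ge ⟪γ, α i⟫ 0 with hneg | hnn
    · refine ⟨i, hi, h.add_mem_of_inner_neg hγ (h.base_mem i) ?_ hneg⟩
      refine h.ne_neg_of_coeff (h.base_mem i) hj ?_
      classical
      rw [h.coeff_base]
      split_ifs <;> simp
    · have hβi : β ≠ α i := by
        rintro rfl
        have h1 := h.coeff_base_self i
        have h2 := h.nonneg_of_coeff_pos hγ hj i
        have h3 := hle j
        rcases eq_or_ne j i with rfl | hji
        · lia
        · rw [h.coeff_base_of_ne hji] at h3
          lia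
      have hm := h.sub_mem_of_inner_pos hβ (h.base_mem i) hβi (by linarith)
      by_cases heq : β - α i = γ
      · exact ⟨i, hi, by rwa [← heq, sub_add_cancel]⟩
      have hc' := h.coeff_sub hβ (h.base_mem i) hm
      obtain ⟨l, hl, hlR⟩ := ih hm heq (fun l => by
          classical
          rw [hc', h.coeff_base]
          have := hle l
          split_ifs with hli
          · subst hli; lia
          · lia) (by
          simp only [hc', Finset.sum_sub_distrib, h.sum_coeff_base] at hN ⊢
          push_cast at hN
          lia)
      refine ⟨l, hl.trans_le ?_, hlR⟩
      classical
      rw [hc', h.coeff_base]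
      split_ifs <;> lia

/-- For a root of level at least two there is a root of level one less. -/
lemma exists_coeff_pred (h : IsBasedRootSystem R α c) (hfin : R.Finite) {j : ι} {m : ℤ}
    (hm : 2 ≤ m) (hex : ∃ β ∈ R, c β j = m) : ∃ β ∈ R, c β j = m - 1 := by
  obtain ⟨β, ⟨hβ, hβj⟩, hmin⟩ := Set.exists_min_image {β | β ∈ R ∧ c β j = m}
    (fun β => ∑ i, c β i) (hfin.subset fun _ hx => hx.1) hex
  have hnn := h.nonneg_of_coeff_pos hβ (j := j) (by lia)
  have hsum := h.eq_sum β hβ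
  obtain ⟨i, hi, hpos⟩ := exists_pos_coeff_inner_pos (b := α) (x := fun i => (c β i : ℝ))
    (fun i => by exact_mod_cast hnn i)
    (by rw [← hsum]; exact fun h0 => h.zero_notMem (h0 ▸ hβ))
  rw [← hsum] at hpos
  have hmem := h.sub_mem_of_inner_pos hβ (h.base_mem i) (by
    rintro rfl
    rcases eq_or_ne j i with rfl | hji
    · rw [h.coeff_base_self] at hβj; lia
    · rw [h.coeff_base_of_ne hji] at hβj; lia) hpos
  have hc' := h.coeff_sub hβ (h.base_mem i) hmem
  rcases eq_or_ne j i with rfl | hji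
  · exact ⟨_, hmem, by rw [hc', h.coeff_base_self, hβj]⟩
  · have := hmin _ ⟨hmem, by rw [hc', h.coeff_base_of_ne hji, hβj, sub_zero]⟩
    simp only [hc', Finset.sum_sub_distrib, h.sum_coeff_base] at this
    lia

lemma exists_coeff_eq (h : IsBasedRootSystem R α c) (hfin : R.Finite) {j : ι} {θ : V}
    (hθ : θ ∈ R) {k : ℤ} (hk1 : 1 ≤ k) (hk2 : k ≤ c θ j) : ∃ β ∈ R, c β j = k := by
  induction k, hk2 using Int.leInductionDown with
  | base => exact ⟨θ, hθ, rfl⟩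
  | pred m _ ih => exact h.exists_coeff_pred hfin (by lia) (ih (by lia))

/-- A root of positive level to which no `α i`, `i ≠ j`, can be added has full support. -/
lemma coeff_pos_of_maximal (h : IsBasedRootSystem R α c) (hfin : R.Finite) {θ : V}
    (hθ : θ ∈ R) (hhigh : ∀ β ∈ R, ∀ i, c β i ≤ c θ i) {j : ι} {β : V} (hβ : β ∈ R)
    (hβj : 0 < c β j) (hdom : ∀ i, i ≠ j → 0 ≤ ⟪β, α i⟫) (i : ι) : 1 ≤ c β i := by
  have hnn := h.nonneg_of_coeff_pos hβ hβj
  by_contra! hi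
  have hi0 : c β i = 0 := le_antisymm (by lia) (hnn i)
  obtain ⟨γ, ⟨hγ, hγj, hγs⟩, hmax⟩ := Set.exists_max_image
    {γ | γ ∈ R ∧ 0 < c γ j ∧ ∀ l, c β l = 0 → c γ l = 0}
    (fun γ => ∑ i, c γ i) (hfin.subset fun _ hx => hx.1) ⟨β, hβ, hβj, fun _ hl => hl⟩
  have hγnn := h.nonneg_of_coeff_pos hγ hγj
  have hθγ : θ ≠ γ := by
    rintro rfl
    have h1 := hhigh _ (h.base_mem i) i
    rw [h.coeff_base_self, hγs i hi0] at h1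
    lia
  obtain ⟨l, -, hl⟩ := h.exists_add_base_mem hθ hγ hθγ (hhigh γ hγ) hγj
  have hc' := h.coeff_add hγ (h.base_mem l) hl
  by_cases hβl : c β l = 0
  · have horth : ∀ m, c β m ≠ 0 → ⟪α m, α l⟫ = 0 := by
      have hnonpos : ∀ m ∈ Finset.univ, (c β m : ℝ) * ⟪α m, α l⟫ ≤ 0 := by
        intro m _
        rcases eq_or_ne m l with rfl | hml
        · simp [hβl]
        · exact mul_nonpos_of_nonneg_of_nonpos (by exact_mod_cast hnn m)
            (h.inner_base_nonpos hml)
      have hlj : l ≠ j := by rintro rfl; lia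
      have hd := hdom l hlj
      rw [h.eq_sum β hβ] at hd
      simp only [sum_inner, real_inner_smul_left] at hd
      have h0 := (Finset.sum_eq_zero_iff_of_nonpos hnonpos).1
        (le_antisymm (Finset.sum_nonpos hnonpos) hd)
      exact fun m hm => (mul_eq_zero.1 (h0 m (Finset.mem_univ _))).resolve_left
        (by exact_mod_cast hm)
    have hγl : ⟪γ, α l⟫ = 0 := by
      rw [h.eq_sum γ hγ]
      simp only [sum_inner, real_inner_smul_left]
      refine Finset.sum_eq_zero fun m _ => ?_
      by_cases hm : c β m = 0
      · simp [hγs m hm]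
      · simp [horth m hm]
    have hαl : ⟪α l, α l⟫ ≠ 0 := fun h0 =>
      h.zero_notMem (inner_self_eq_zero.1 h0 ▸ h.base_mem l)
    have hr := h.refl_mem (α l) (h.base_mem l) _ hl
    rw [inner_add_left, hγl, zero_add, mul_div_cancel_right₀ _ hαl, two_smul,
      add_sub_add_right_eq_sub] at hr
    have hcs := h.coeff_sub hγ (h.base_mem l) hr
    have h1 := hcs l
    rw [h.coeff_base_self, hγs l hβl] at h1
    have hjl : j ≠ l := by rintro rfl; lia
    have h2 := hcs j
    rw [h.coeff_base_of_ne hjl] at h2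
    have := h.nonneg_of_coeff_pos hr (j := j) (by lia) l
    lia
  · have := hmax _ ⟨hl, by
      rcases eq_or_ne j l with rfl | hjl
      · rw [hc', h.coeff_base_self]; lia
      · rw [hc', h.coeff_base_of_ne hjl]; lia, fun m hm => by
      rw [hc', h.coeff_base_of_ne (by rintro rfl; exact hβl hm), hγs m hm, add_zero]⟩
    simp only [hc', Finset.sum_add_distrib, h.sum_coeff_base] at this
    lia

/-- The simple roots other than `α j`, together with a root `α₀` of positive level, are
linearly independent. -/
lemma linearIndependent_update [DecidableEq ι] (h : IsBasedRootSystem R α c) {α₀ : V}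
    (hα₀ : α₀ ∈ R) {j : ι} (hj : 0 < c α₀ j) :
    LinearIndependent ℝ (Function.update α j α₀) := by
  rw [Fintype.linearIndependent_iff]
  intro g hg
  have hexp : ∑ i, ((if i = j then 0 else g i) + g j * c α₀ i) • α i = 0 := by
    rw [← hg]
    simp only [add_smul, mul_smul, Finset.sum_add_distrib, ← Finset.smul_sum]
    rw [← h.eq_sum α₀ hα₀, ← Finset.add_sum_erase _ _ (Finset.mem_univ j),
      ← Finset.add_sum_erase _ (fun i => g i • Function.update α j α₀ i) (Finset.mem_univ j)]
    simp only [if_true, zero_smul, zero_add, Function.update_self]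
    rw [add_comm]
    congr 1
    refine Finset.sum_congr rfl fun i hi => ?_
    have hij := Finset.ne_of_mem_erase hi
    simp [hij]
  have hz := Fintype.linearIndependent_iff.1 h.linearIndependent _ hexp
  have hgj : g j = 0 := by
    have := hz j
    simpa [hj.ne'] using this
  intro i
  rcases eq_or_ne i j with rfl | hij
  · exact hgj
  · simpa [hij, hgj] using hz i

lemma eq_sum_update [DecidableEq ι] (h : IsBasedRootSystem R α c) {α₀ : V}
    (hα₀ : α₀ ∈ R) {j : ι} (hj : 0 < c α₀ j) {β : V} (hβ : β ∈ R) :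
    β = ∑ i, (if i = j then (c β j / c α₀ j : ℝ)
      else c β i - (c β j / c α₀ j : ℝ) * c α₀ i) • Function.update α j α₀ i := by
  have hj' : (c α₀ j : ℝ) ≠ 0 := by exact_mod_cast hj.ne'
  have hβs := h.eq_sum β hβ
  have hα₀s := h.eq_sum α₀ hα₀
  rw [← Finset.add_sum_erase _ _ (Finset.mem_univ j), ← sub_eq_iff_eq_add'] at hβs hα₀s
  rw [← Finset.add_sum_erase _ _ (Finset.mem_univ j)]
  have hrest : ∑ i ∈ Finset.univ.erase j, (if i = j then (c β j / c α₀ j : ℝ)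
      else c β i - (c β j / c α₀ j : ℝ) * c α₀ i) • Function.update α j α₀ i
      = ∑ i ∈ Finset.univ.erase j, (c β i : ℝ) • α i
        - (c β j / c α₀ j : ℝ) • ∑ i ∈ Finset.univ.erase j, (c α₀ i : ℝ) • α i := by
    rw [Finset.smul_sum, ← Finset.sum_sub_distrib]
    refine Finset.sum_congr rfl fun i hi => ?_
    have hij := Finset.ne_of_mem_erase hi
    rw [if_neg hij, Function.update_of_ne hij, sub_smul, mul_smul]
  rw [hrest, ← hβs, ← hα₀s, smul_sub, smul_smul, div_mul_cancel₀ _ hj', if_pos rfl,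
    Function.update_self]
  abel

/-- Two roots of the same positive level to which no `α i`, `i ≠ j`, can be added coincide. -/
lemma eq_of_maximal (h : IsBasedRootSystem R α c) {j : ι} {α₀ : V} (hα₀ : α₀ ∈ R)
    (hα₀j : 0 < c α₀ j) (hobt : ∀ i, i ≠ j → ⟪α₀, α i⟫ ≤ 0) {β γ : V} (hβ : β ∈ R)
    (hγ : γ ∈ R) (hlevel : c β j = c γ j) (hβj : 0 < c β j)
    (hβdom : ∀ i, i ≠ j → 0 ≤ ⟪β, α i⟫) (hγdom : ∀ i, i ≠ j → 0 ≤ ⟪γ, α i⟫)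
    (hβ₀ : 0 ≤ ⟪β, α₀⟫) (hγ₀ : 0 ≤ ⟪γ, α₀⟫)
    (hβmax : ∀ i, i ≠ j → β + α i ∉ R) (hγmax : ∀ i, i ≠ j → γ + α i ∉ R) : β = γ := by
  classical
  by_contra hne
  have hli := h.linearIndependent_update hα₀ hα₀j
  have hβs := h.eq_sum_update hα₀ hα₀j hβ
  have hγs := h.eq_sum_update hα₀ hα₀j hγ
  have hα₀j' : (0 : ℝ) < c α₀ j := by exact_mod_cast hα₀j
  have hβj' : (0 : ℝ) < c β j := by exact_mod_cast hβj
  have hγj' : (0 : ℝ) < c γ j := by exact_mod_cast hlevel ▸ hβj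
  have hpos : 0 < ⟪β, γ⟫ := by
    rw [hβs, hγs]
    refine inner_pos_of_obtuse hli ?_ ?_ ?_ (j := j) ?_ ?_
    · intro i l hil
      rcases eq_or_ne i j with rfl | hij
      · simpa [Function.update_of_ne hil.symm] using hobt l hil.symm
      · rcases eq_or_ne l j with rfl | hlj
        · simpa [Function.update_of_ne hij, real_inner_comm] using hobt i hij
        · simpa [Function.update_of_ne hij, Function.update_of_ne hlj]
            using h.inner_base_nonpos hil
    · intro i
      rw [← hβs]
      rcases eq_or_ne i j with rfl | hij
      · simpa using hβ₀
      · simpa [Function.update_of_ne hij] using hβdom i hij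
    · intro i
      rw [← hγs]
      rcases eq_or_ne i j with rfl | hij
      · simpa using hγ₀
      · simpa [Function.update_of_ne hij] using hγdom i hij
    · simpa using div_pos hβj' hα₀j'
    · simpa using div_pos hγj' hα₀j'
  have hm := h.sub_mem_of_inner_pos hβ hγ hne hpos
  have hc' := h.coeff_sub hβ hγ hm
  rcases h.sign _ hm with hs | hs
  · obtain ⟨i, hi, hiR⟩ := h.exists_add_base_mem hβ hγ hne
      (fun i => by have := hs i; have := hc' i; lia) (hlevel ▸ hβj)
    exact hγmax i (by rintro rfl; lia) hiR
  · obtain ⟨i, hi, hiR⟩ := h.exists_add_base_mem hγ hβ (Ne.symm hne)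
      (fun i => by have := hs i; have := hc' i; lia) hβj
    exact hβmax i (by rintro rfl; lia) hiR

end IsBasedRootSystem

/-- For 1 ≤ k ≤ a_j − 1 the set {α ∈ R⁺ : c_j(α) = k} is nonempty with a
unique element θ_k of maximal height, which satisfies (θ_k, α_i) ≥ 0 and θ_k + α_i ∉ R for
i ≠ j; (θ_k, α₀) ≥ 0 and θ_k + α₀ ∉ R; θ_k + α_j ∈ R; c_i(θ_k) ≥ 1 for all i; and
θ − θ_k ∈ R⁺ with c_j(θ − θ_k) = a_j − k. -/
theorem statement5
    {V : Type*} [NormedAddCommGroup V] [InnerProductSpace ℝ V] [FiniteDimensional ℝ V]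
    (R : Set V) (hRfin : R.Finite) (hR0 : (0 : V) ∉ R)
    (hRspan : Submodule.span ℝ R = ⊤)
    (hRneg : ∀ β ∈ R, -β ∈ R)
    (hRrefl : ∀ β ∈ R, ∀ γ ∈ R, γ - (2 * ⟪γ, β⟫ / ⟪β, β⟫) • β ∈ R)
    (hRcrys : ∀ β ∈ R, ∀ γ ∈ R, ∃ k : ℤ, 2 * ⟪γ, β⟫ / ⟪β, β⟫ = (k : ℝ))
    (hRred : ∀ β ∈ R, ∀ s : ℝ, s • β ∈ R → s = 1 ∨ s = -1)
    (hRirr : ∀ R₁ R₂ : Set V, R = R₁ ∪ R₂ → (∀ a ∈ R₁, ∀ b ∈ R₂, ⟪a, b⟫ = 0) →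
      R₁ = ∅ ∨ R₂ = ∅)
    (n : ℕ) (α : Fin n → V) (hα : ∀ i, α i ∈ R)
    (hαind : LinearIndependent ℝ α)
    (c : V → Fin n → ℤ)
    (hc : ∀ β ∈ R, β = ∑ i, (c β i : ℝ) • α i)
    (hbase : ∀ β ∈ R, (∀ i, 0 ≤ c β i) ∨ (∀ i, c β i ≤ 0))
    (Rpos : Set V) (hRpos : Rpos = {β ∈ R | ∀ i, 0 ≤ c β i})
    (θ : V) (hθ : θ ∈ R) (hθhigh : ∀ β ∈ R, ∀ i, c β i ≤ c θ i)
    (j : Fin n) (haj : 2 ≤ c θ j)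
    (α₀ : V) (hα₀pos : α₀ ∈ Rpos) (hα₀j : c α₀ j = c θ j)
    (hα₀min : ∀ β ∈ Rpos, c β j = c θ j → ∑ i, c α₀ i ≤ ∑ i, c β i)
    (k : ℤ) (hk1 : 1 ≤ k) (hk2 : k ≤ c θ j - 1) :
    ∃ θk ∈ Rpos, c θk j = k ∧
      (∀ β ∈ Rpos, c β j = k → ∑ i, c β i ≤ ∑ i, c θk i) ∧
      (∀ β ∈ Rpos, c β j = k →
        (∀ γ ∈ Rpos, c γ j = k → ∑ i, c γ i ≤ ∑ i, c β i) → β = θk) ∧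
      (∀ i, i ≠ j → 0 ≤ ⟪θk, α i⟫ ∧ θk + α i ∉ R) ∧
      (0 ≤ ⟪θk, α₀⟫ ∧ θk + α₀ ∉ R) ∧
      θk + α j ∈ R ∧
      (∀ i, 1 ≤ c θk i) ∧
      θ - θk ∈ Rpos ∧ c (θ - θk) j = c θ j - k := by
  subst hRpos
  have h : IsBasedRootSystem R α c := ⟨hR0, hRneg, hRrefl, hRcrys, hα, hαind, hc, hbase⟩
  obtain ⟨hα₀, -⟩ := hα₀pos
  have hobt : ∀ i, i ≠ j → ⟪α₀, α i⟫ ≤ 0 := by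
    intro i hij
    by_contra! hcon
    have hm := h.sub_mem_of_inner_pos hα₀ (hα i) (by
      rintro rfl
      rw [h.coeff_base_of_ne hij.symm] at hα₀j
      lia) hcon
    have hc' := h.coeff_sub hα₀ (hα i) hm
    have hj : c (α₀ - α i) j = c θ j := by
      rw [hc', h.coeff_base_of_ne hij.symm, hα₀j, sub_zero]
    have := hα₀min _ ⟨hm, h.nonneg_of_coeff_pos hm (j := j) (by lia)⟩ hj
    simp only [hc', Finset.sum_sub_distrib, h.sum_coeff_base] at this
    lia
  have hmaxadd : ∀ β ∈ R, c β j = k →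
      (∀ γ ∈ R, c γ j = k → ∑ i, c γ i ≤ ∑ i, c β i) → ∀ i, i ≠ j → β + α i ∉ R := by
    intro β hβ hβj hβmax i hij hm
    have hc' := h.coeff_add hβ (hα i) hm
    have := hβmax _ hm (by rw [hc', h.coeff_base_of_ne hij.symm, hβj, add_zero])
    simp only [hc', Finset.sum_add_distrib, h.sum_coeff_base] at this
    lia
  have hadd₀ : ∀ β ∈ R, c β j = k → β + α₀ ∉ R := by
    intro β hβ hβj hm
    have h1 := h.coeff_add hβ hα₀ hm j
    have h2 := hθhigh _ hm j
    lia
  have hdom₀ : ∀ β ∈ R, c β j = k → 0 ≤ ⟪β, α₀⟫ := fun β hβ hβj =>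
    h.inner_nonneg_of_add_notMem hβ hα₀
      (h.ne_neg_of_coeff hα₀ (j := j) (by lia) (by lia)) (hadd₀ β hβ hβj)
  have hdom : ∀ β ∈ R, c β j = k → (∀ i, i ≠ j → β + α i ∉ R) →
      ∀ i, i ≠ j → 0 ≤ ⟪β, α i⟫ := fun β hβ hβj hβmax i hij =>
    h.inner_nonneg_of_add_notMem hβ (hα i)
      (h.ne_neg_of_coeff (hα i) (j := j) (by lia) (h.coeff_base_of_ne hij.symm).ge)
      (hβmax i hij)
  obtain ⟨θk, ⟨hθk, hθkj⟩, hθkmax⟩ := Set.exists_max_image {β | β ∈ R ∧ c β j = k}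
    (fun β => ∑ i, c β i) (hRfin.subset fun _ hx => hx.1)
    (h.exists_coeff_eq hRfin hθ hk1 (by lia))
  have hθkadd := hmaxadd θk hθk hθkj fun γ hγ hγj => hθkmax γ ⟨hγ, hγj⟩
  have hθkdom := hdom θk hθk hθkj hθkadd
  have hsupp := h.coeff_pos_of_maximal hRfin hθ hθhigh hθk (j := j) (by lia) hθkdom
  have hne : θ ≠ θk := by rintro rfl; lia
  have hθdom : ∀ i, 0 ≤ ⟪θ, α i⟫ := fun i =>
    h.inner_nonneg_of_add_notMem hθ (hα i)
      (h.ne_neg_of_coeff (hα i) (j := i)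
        (by have := hθhigh _ (hα i) i; rw [h.coeff_base_self] at this; lia)
        (by rw [h.coeff_base_self]; lia))
      (fun hm => by
        have h1 := h.coeff_add hθ (hα i) hm i
        have h2 := hθhigh _ hm i
        rw [h.coeff_base_self] at h1
        lia)
  have hinner : 0 < ⟪θ, θk⟫ := by
    have hsum := hc θ hθ
    obtain ⟨i, -, hi⟩ := exists_pos_coeff_inner_pos (b := α) (x := fun i => (c θ i : ℝ))
      (fun i => by exact_mod_cast h.nonneg_of_coeff_pos hθ (j := j) (by lia) i)
      (by rw [← hsum]; exact fun h0 => hR0 (h0 ▸ hθ))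
    rw [← hsum] at hi
    have hcpos : ∀ i, (0 : ℝ) < c θk i := fun i => by exact_mod_cast hsupp i
    rw [hc θk hθk, inner_sum]
    simp only [real_inner_smul_right]
    exact Finset.sum_pos' (fun l _ => mul_nonneg (hcpos l).le (hθdom l))
      ⟨i, Finset.mem_univ _, mul_pos (hcpos i) hi⟩
  have hdiff := h.sub_mem_of_inner_pos hθ hθk hne hinner
  have hdiffj : c (θ - θk) j = c θ j - k := by rw [h.coeff_sub hθ hθk hdiff, hθkj]
  refine ⟨θk, ⟨hθk, h.nonneg_of_coeff_pos hθk (j := j) (by lia)⟩, hθkj,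
    fun β hβ hβj => hθkmax β ⟨hβ.1, hβj⟩, ?_, fun i hij => ⟨hθkdom i hij, hθkadd i hij⟩,
    ⟨hdom₀ θk hθk hθkj, hadd₀ θk hθk hθkj⟩, ?_, hsupp,
    ⟨hdiff, h.nonneg_of_coeff_pos hdiff (j := j) (by lia)⟩, hdiffj⟩
  · intro β hβ hβj hβmax
    have hβadd := hmaxadd β hβ.1 hβj fun γ hγ hγj =>
      hβmax γ ⟨hγ, h.nonneg_of_coeff_pos hγ (j := j) (by lia)⟩ hγj
    exact h.eq_of_maximal hα₀ (by lia) hobt hβ.1 hθk (hβj.trans hθkj.symm) (by lia)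
      (hdom β hβ.1 hβj hβadd) hθkdom (hdom₀ β hβ.1 hβj) (hdom₀ θk hθk hθkj) hβadd hθkadd
  · obtain ⟨i, -, hi⟩ := h.exists_add_base_mem hθ hθk hne (hθhigh θk hθk) (j := j) (by lia)
    rcases eq_or_ne i j with rfl | hij
    · exact hi
    · exact absurd hi (hθkadd i hij)
end

section
/- If c_j^∨(α_0) = 1, then c_i^∨(α_0) ≤ 1 for every i ∈ {1, …, n}. -/
open RealInnerProductSpace

lemma pairing_descent_arith {m x y p q p₀ q₀ a : ℤ} (hm : 2 ≤ m) (hm3 : 1 * m ≤ 3)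
    (hx : 0 < x) (hp : 0 < p) (hq : 0 < q) (hy : 0 < y) (hpq : p * q ≤ 3)
    (h : x * p = y * q) (h₀ : x * p₀ = y * q₀) (hq₀ : q₀ ≤ 0) (hlow : 2 - m ≤ x * p₀)
    (hinc : x * p - x * p₀ ≤ m) (hqa : q = q₀ + m * a) : x = m ∧ y = 1 ∧ x * p = m := by
  have hq3 : q ≤ 3 := by nlinarith
  have hq₀' : -1 ≤ q₀ := by nlinarith
  obtain rfl | rfl : q₀ = -1 ∨ q₀ = 0 := by omega
  · obtain rfl : y = 1 := by omega
    have hx1 : x ∣ 1 := ⟨-p₀, by linarith⟩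
    obtain rfl : x = 1 := Int.eq_one_of_dvd_one hx.le hx1
    obtain rfl : m = 3 := by omega
    obtain rfl : q = 2 := by omega
    omega
  · have ha0 : 0 < a := by
      by_contra hn
      have : m * a ≤ 0 := mul_nonpos_of_nonneg_of_nonpos (by omega) (by omega)
      omega
    have ha : a = 1 := by
      by_contra hn
      have : 2 * 2 ≤ m * a := mul_le_mul hm (by omega) (by omega) (by omega)
      omega
    subst ha
    obtain rfl : q = m := by omega
    obtain rfl : p = 1 := by
      by_contra hn
      have : 2 * 2 ≤ p * q := mul_le_mul (by omega) hm (by omega) (by omega)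
      omega
    obtain rfl : y = 1 := by
      by_contra hn
      have : 2 * q ≤ y * q := by gcongr; omega
      omega
    omega

/-- Abstract descent on roots. `P β i` and `Q β i` stand for the pairings `⟨α i, β^∨⟩` and
`⟨β, (α i)^∨⟩`, and `s j β` for the reflection of `β` in `α j`. -/
theorem corootCoeff_le_one_of_pairing_nonpos {V ι : Type*} [Fintype ι] [DecidableEq ι]
    (R : Set V) (α : ι → V) (c cv P Q : V → ι → ℤ) (s : ι → V → V)
    (hcα : ∀ i, c (α i) i = 1) (hcvα : ∀ i l, cv (α i) l ≤ 1)
    (hsum : ∀ β ∈ R, ∑ i, c β i * P β i = 2)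
    (hcP : ∀ β ∈ R, ∀ i, c β i * P β i = cv β i * Q β i)
    (hPQ : ∀ β ∈ R, ∀ i, 0 < P β i ↔ 0 < Q β i)
    (hpos : ∀ β ∈ R, ∀ i, 0 < c β i ↔ 0 < cv β i)
    (hprod : ∀ β ∈ R, (∀ i, 0 ≤ c β i) → ∀ i, β = α i ∨ P β i * Q β i ≤ 3)
    (hsR : ∀ β ∈ R, ∀ i, s i β ∈ R)
    (hsc : ∀ β ∈ R, ∀ i, c (s i β) i = c β i - Q β i)
    (hsc' : ∀ β ∈ R, ∀ i l, l ≠ i → c (s i β) l = c β l)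
    (hscv' : ∀ β ∈ R, ∀ i l, l ≠ i → cv (s i β) l = cv β l)
    (hsQ : ∀ β ∈ R, ∀ i l, Q (s i β) l = Q β l - Q β i * Q (α i) l)
    (hA : ∀ i l, i ≠ l → Q (α i) l ≤ 0)
    (N : ℕ) : ∀ β ∈ R, (∀ i, 0 ≤ c β i) → ∑ i, c β i < N → ∀ j, cv β j = 1 → 2 ≤ c β j →
      (∀ l, l ≠ j → 0 < c β l → Q β l ≤ 0) → ∀ i, cv β i ≤ 1 := by
  induction N with
  | zero =>
    intro β _ hβ h
    have := Finset.sum_nonneg fun i (_ : i ∈ Finset.univ) => hβ i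
    simp only [Nat.cast_zero] at h
    omega
  | succ N ih =>
    intro β hβR hβ hN j hj hm hneg i
    obtain ⟨m, hm'⟩ : ∃ m, m = c β j := ⟨_, rfl⟩
    have hterm : ∀ l, l ≠ j → c β l * P β l ≤ 0 := by
      intro l hl
      rcases (hβ l).lt_or_eq with h | h
      · rw [hcP β hβR l]
        exact mul_nonpos_of_nonneg_of_nonpos ((hpos β hβR l).1 h).le (hneg l hl h)
      · rw [← h, zero_mul]
    have hs1 := hsum β hβR
    rw [← Finset.add_sum_erase _ _ (Finset.mem_univ j)] at hs1
    have hs1' : ∑ l ∈ Finset.univ.erase j, c β l * P β l ≤ 0 :=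
      Finset.sum_nonpos fun l hl => hterm l (Finset.ne_of_mem_erase hl)
    have hPj : 0 < P β j := by
      by_contra h
      have := mul_nonpos_of_nonneg_of_nonpos (hβ j) (not_lt.1 h)
      omega
    have hQj : c β j * P β j = Q β j := by rw [hcP β hβR j, hj, one_mul]
    have hne : β ≠ α j := by
      intro h
      rw [h, hcα] at hm
      omega
    have h3 : P β j * Q β j ≤ 3 := (hprod β hβR hβ j).resolve_left hne
    have hP1 : P β j = 1 := by
      rw [← hQj] at h3
      nlinarith
    rw [hP1, mul_one, ← hm'] at hQj
    rw [hP1, ← hQj] at h3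
    rw [hP1, ← hm'] at hs1
    rw [← hm'] at hm
    have hγR := hsR β hβR j
    have hγj : c (s j β) j = 0 := by rw [hsc β hβR]; omega
    have hγ0 : ∀ l, 0 ≤ c (s j β) l := by
      intro l
      by_cases h : l = j
      · rw [h, hγj]
      · rw [hsc' β hβR j l h]; exact hβ l
    have hs2 := hsum _ hγR
    have hcv1 : ∀ l, cv (s j β) l ≤ 1 → cv β l ≤ 1 := by
      intro l hl
      by_cases h : l = j
      · rw [h, hj]
      · rwa [hscv' β hβR j l h] at hl
    have hγN : ∑ l, c (s j β) l < N := by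
      rw [← Finset.add_sum_erase _ _ (Finset.mem_univ j)] at hN ⊢
      rw [Finset.sum_congr rfl fun l hl => hsc' β hβR j l (Finset.ne_of_mem_erase hl), hγj]
      push_cast at hN
      simp only [← hm'] at hN
      have : ∑ l ∈ Finset.univ.erase j, c β l = (Finset.univ.erase j).sum (c β) := rfl
      omega
    obtain ⟨k, -, hk⟩ : ∃ k ∈ Finset.univ, 0 < c (s j β) k * P (s j β) k := by
      by_contra! h
      have := Finset.sum_nonpos h
      omega
    rw [← Finset.add_sum_erase _ _ (Finset.mem_univ j), hγj, zero_mul, zero_add] at hs2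
    have hkj : k ≠ j := by
      rintro rfl
      rw [hγj] at hk
      omega
    by_cases hγα : ∃ k, s j β = α k
    · obtain ⟨k, hk⟩ := hγα
      exact hcv1 i (hk ▸ hcvα k i)
    push Not at hγα
    have hQ' : ∀ l, Q (s j β) l = Q β l + m * (-Q (α j) l) := by
      intro l
      rw [hsQ β hβR, ← hQj]; ring
    -- the summand at `l` does not decrease, and the increments add up to `m`
    have hmono : ∀ l, l ≠ j → 0 ≤ c (s j β) l * P (s j β) l - c β l * P β l := by
      intro l hl
      rw [hcP _ hγR, hcP _ hβR, hscv' β hβR j l hl, hQ']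
      rcases (hβ l).lt_or_eq with h | h
      · have h1 := (hpos β hβR l).1 h
        have h2 := hA j l hl.symm
        have : 0 ≤ cv β l * (m * (-Q (α j) l)) :=
          mul_nonneg h1.le (mul_nonneg (by omega) (by omega))
        linarith
      · have h1 := hcP β hβR l
        have h2 := hcP _ hγR l
        rw [hsc' β hβR j l hl, ← h, hscv' β hβR j l hl, hQ'] at h2
        rw [← h] at h1
        linarith
    have hinc : ∑ l ∈ Finset.univ.erase j, (c (s j β) l * P (s j β) l - c β l * P β l) = m := by
      rw [Finset.sum_sub_distrib]; omega
    have hlow : ∀ l, l ≠ j → 2 - m ≤ c β l * P β l := by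
      intro l hl
      have := Finset.single_le_sum (f := fun l => -(c β l * P β l)) (s := Finset.univ.erase j)
        (fun l hl => neg_nonneg.2 (hterm l (Finset.ne_of_mem_erase hl)))
        (Finset.mem_erase.2 ⟨hl, Finset.mem_univ l⟩)
      rw [Finset.sum_neg_distrib] at this
      omega
    have hkey : ∀ l, l ≠ j → 0 < c (s j β) l * P (s j β) l →
        c (s j β) l = m ∧ cv (s j β) l = 1 ∧ c (s j β) l * P (s j β) l = m := by
      intro l hl hlpos
      have hcl : 0 < c (s j β) l := by
        rcases (hγ0 l).lt_or_eq with h | h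
        · exact h
        · rw [← h] at hlpos; omega
      have hPl : 0 < P (s j β) l := pos_of_mul_pos_right hlpos hcl.le
      have hQl : 0 < Q (s j β) l := (hPQ _ hγR l).1 hPl
      have hcvl : 0 < cv (s j β) l := (hpos _ hγR l).1 hcl
      have h4 : P (s j β) l * Q (s j β) l ≤ 3 := (hprod _ hγR hγ0 l).resolve_left (hγα l)
      have h5 := hcP _ hγR l
      have h6 := hcP _ hβR l
      have h7 := hneg l hl (by rwa [hsc' β hβR j l hl] at hcl)
      have h8 := hlow l hl
      have h9 := Finset.single_le_sum (f := fun l => c (s j β) l * P (s j β) l - c β l * P β l)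
        (s := Finset.univ.erase j) (fun l hl => hmono l (Finset.ne_of_mem_erase hl))
        (Finset.mem_erase.2 ⟨hl, Finset.mem_univ l⟩)
      rw [hinc] at h9
      have h10 := hterm l hl
      have h11 := hQ' l
      rw [← hscv' β hβR j l hl, ← hsc' β hβR j l hl] at h6
      rw [← hsc' β hβR j l hl] at h8 h9 h10
      have h12 := hA j l hl.symm
      generalize -Q (α j) l = a at *
      generalize c (s j β) l = x at *
      generalize cv (s j β) l = y at *
      generalize P (s j β) l = p at *
      generalize Q (s j β) l = q at *
      generalize Q β l = q0 at *
      generalize P β l = p0 at *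
      exact pairing_descent_arith hm h3 hcl hPl hQl hcvl h4 h5 h6 h7 h8 h9 h11
    obtain ⟨hk1, hk2, hk3⟩ := hkey k hkj hk
    refine hcv1 i (ih _ hγR hγ0 hγN k hk2 (by omega) ?_ i)
    intro l hlk hlpos
    by_contra! hlQ
    have hlj : l ≠ j := by
      rintro rfl
      omega
    obtain ⟨-, -, hl3⟩ := hkey l hlj (mul_pos hlpos ((hPQ _ hγR l).2 hlQ))
    have := Finset.sum_le_sum_of_subset_of_nonneg
      (f := fun l => c (s j β) l * P (s j β) l - c β l * P β l)
      (s := {k, l}) (t := Finset.univ.erase j) (by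
        intro x hx
        simp only [Finset.mem_insert, Finset.mem_singleton] at hx
        rcases hx with rfl | rfl <;> simp [hkj, hlj])
      (fun l hl _ => hmono l (Finset.ne_of_mem_erase hl))
    rw [hinc, Finset.sum_pair hlk.symm, hk3, hl3] at this
    have h1 := hterm k hkj
    have h2 := hterm l hlj
    omega

/-- If c_j^∨(α₀) = 1 then c_i^∨(α₀) ≤ 1 for every i, where the coroot
coefficients are defined by α^∨ = Σ_i c_i^∨(α) α_i^∨ and α^∨ = 2α/(α,α). -/
theorem statement6
    {V : Type*} [NormedAddCommGroup V] [InnerProductSpace ℝ V] [FiniteDimensional ℝ V]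
    (R : Set V) (hRfin : R.Finite) (hR0 : (0 : V) ∉ R)
    (hRspan : Submodule.span ℝ R = ⊤)
    (hRneg : ∀ β ∈ R, -β ∈ R)
    (hRrefl : ∀ β ∈ R, ∀ γ ∈ R, γ - (2 * ⟪γ, β⟫ / ⟪β, β⟫) • β ∈ R)
    (hRcrys : ∀ β ∈ R, ∀ γ ∈ R, ∃ k : ℤ, 2 * ⟪γ, β⟫ / ⟪β, β⟫ = (k : ℝ))
    (hRred : ∀ β ∈ R, ∀ s : ℝ, s • β ∈ R → s = 1 ∨ s = -1)
    (hRirr : ∀ R₁ R₂ : Set V, R = R₁ ∪ R₂ → (∀ a ∈ R₁, ∀ b ∈ R₂, ⟪a, b⟫ = 0) →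
      R₁ = ∅ ∨ R₂ = ∅)
    (n : ℕ) (α : Fin n → V) (hα : ∀ i, α i ∈ R)
    (hαind : LinearIndependent ℝ α)
    (c : V → Fin n → ℤ)
    (hc : ∀ β ∈ R, β = ∑ i, (c β i : ℝ) • α i)
    (hbase : ∀ β ∈ R, (∀ i, 0 ≤ c β i) ∨ (∀ i, c β i ≤ 0))
    (Rpos : Set V) (hRpos : Rpos = {β ∈ R | ∀ i, 0 ≤ c β i})
    (θ : V) (hθ : θ ∈ R) (hθhigh : ∀ β ∈ R, ∀ i, c β i ≤ c θ i)
    (j : Fin n) (haj : 2 ≤ c θ j)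
    (cv : V → Fin n → ℤ)
    (hcv : ∀ β ∈ R, (2 / ⟪β, β⟫) • β = ∑ i, (cv β i : ℝ) • ((2 / ⟪α i, α i⟫) • α i))
    (α₀ : V) (hα₀pos : α₀ ∈ Rpos) (hα₀j : c α₀ j = c θ j)
    (hα₀min : ∀ β ∈ Rpos, c β j = c θ j → ∑ i, c α₀ i ≤ ∑ i, c β i)
    (h1 : cv α₀ j = 1) :
    ∀ i, cv α₀ i ≤ 1 := by
  subst hRpos
  have hRpos : ∀ β ∈ R, 0 < ⟪β, β⟫ := fun β hβ =>
    real_inner_self_pos.2 fun h => hR0 (h ▸ hβ)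
  have hαpos : ∀ i, 0 < ⟪α i, α i⟫ := fun i => hRpos _ (hα i)
  have hcoef : ∀ β ∈ R, ∀ a : Fin n → ℝ, β = ∑ i, a i • α i → ∀ i, (c β i : ℝ) = a i := by
    intro β hβ a ha
    refine Fintype.linearIndependent_iff.1 hαind (fun i => c β i - a i) ?_ |> fun h i =>
      sub_eq_zero.1 (h i)
    simp only [sub_smul, Finset.sum_sub_distrib]
    rw [← hc β hβ, ← ha, sub_self]
  have hcα : ∀ i l, c (α i) l = if l = i then 1 else 0 := by
    intro i l
    have := hcoef (α i) (hα i) (fun l => if l = i then 1 else 0) (by simp) l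
    exact_mod_cast this
  have hcvn : ∀ β ∈ R, ∀ i, (cv β i : ℝ) * ⟪β, β⟫ = c β i * ⟪α i, α i⟫ := by
    intro β hβ i
    have h0 := hRpos β hβ
    have h2 := hαpos i
    rw [hcoef β hβ (fun i => ⟪β, β⟫ / 2 * (cv β i * (2 / ⟪α i, α i⟫))) ?_ i]
    · field_simp
    · simp only [← smul_smul, ← Finset.smul_sum]
      rw [← hcv β hβ, smul_smul]
      field_simp
      simp
  have hPex : ∀ β i, ∃ k : ℤ, β ∈ R → 2 * ⟪α i, β⟫ / ⟪β, β⟫ = (k : ℝ) := by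
    intro β i
    by_cases hβ : β ∈ R
    · obtain ⟨k, hk⟩ := hRcrys β hβ (α i) (hα i)
      exact ⟨k, fun _ => hk⟩
    · exact ⟨0, fun h => absurd h hβ⟩
  have hQex : ∀ β i, ∃ k : ℤ, β ∈ R → 2 * ⟪β, α i⟫ / ⟪α i, α i⟫ = (k : ℝ) := by
    intro β i
    by_cases hβ : β ∈ R
    · obtain ⟨k, hk⟩ := hRcrys (α i) (hα i) β hβ
      exact ⟨k, fun _ => hk⟩
    · exact ⟨0, fun h => absurd h hβ⟩
  choose P hP using hPex
  choose Q hQ using hQex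
  have hP' : ∀ β ∈ R, ∀ i, (P β i : ℝ) * ⟪β, β⟫ = 2 * ⟪β, α i⟫ := by
    intro β hβ i
    rw [← hP β i hβ, div_mul_cancel₀ _ (hRpos β hβ).ne', real_inner_comm]
  have hQ' : ∀ β ∈ R, ∀ i, (Q β i : ℝ) * ⟪α i, α i⟫ = 2 * ⟪β, α i⟫ := by
    intro β hβ i
    rw [← hQ β i hβ, div_mul_cancel₀ _ (hαpos i).ne']
  have hQpos : ∀ β ∈ R, ∀ i, 0 < Q β i ↔ 0 < ⟪β, α i⟫ := by
    intro β hβ i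
    rw [← Int.cast_pos (R := ℝ), ← mul_pos_iff_of_pos_right (hαpos i), hQ' β hβ]
    simp
  have hPpos : ∀ β ∈ R, ∀ i, 0 < P β i ↔ 0 < ⟪β, α i⟫ := by
    intro β hβ i
    rw [← Int.cast_pos (R := ℝ), ← mul_pos_iff_of_pos_right (hRpos β hβ), hP' β hβ]
    simp
  have hsR : ∀ β ∈ R, ∀ i, β - (Q β i : ℝ) • α i ∈ R := by
    intro β hβ i
    rw [← hQ β i hβ]
    exact hRrefl _ (hα i) β hβ
  have hsc : ∀ β ∈ R, ∀ i l,
      c (β - (Q β i : ℝ) • α i) l = c β l - if l = i then Q β i else 0 := by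
    intro β hβ i l
    have := hcoef _ (hsR β hβ i) (fun l => c β l - if l = i then (Q β i : ℝ) else 0) (by
      simp only [sub_smul, Finset.sum_sub_distrib, ite_smul, zero_smul, Finset.sum_ite_eq',
        Finset.mem_univ, if_true]
      rw [← hc β hβ]) l
    exact_mod_cast this
  have hsn : ∀ β ∈ R, ∀ i, ⟪β - (Q β i : ℝ) • α i, β - (Q β i : ℝ) • α i⟫ = ⟪β, β⟫ := by
    intro β hβ i
    simp only [inner_sub_left, inner_sub_right, inner_smul_left, inner_smul_right,
      RCLike.conj_to_real, real_inner_comm β (α i)]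
    linear_combination (Q β i : ℝ) * hQ' β hβ i
  have hsc_ne : ∀ β ∈ R, ∀ i l, l ≠ i → c (β - (Q β i : ℝ) • α i) l = c β l := by
    intro β hβ i l hl
    rw [hsc β hβ, if_neg hl, sub_zero]
  have hA : ∀ i l, i ≠ l → ⟪α i, α l⟫ ≤ 0 := by
    intro i l hil
    by_contra! h
    have hq := (hQpos _ (hα i) l).2 h
    have h1 := hsc_ne _ (hα i) l i hil
    have h2 := hsc _ (hα i) l l
    rw [hcα, if_pos rfl] at h1
    rw [hcα, if_neg hil.symm, if_pos rfl] at h2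
    rcases hbase _ (hsR _ (hα i) l) with hb | hb
    · have := hb l
      omega
    · have := hb i
      omega
  obtain ⟨hα₀R, hα₀nn⟩ := hα₀pos
  have hneg : ∀ l, l ≠ j → ⟪α₀, α l⟫ ≤ 0 := by
    intro l hl
    by_contra! h
    have hq := (hQpos _ hα₀R l).2 h
    have hcj := hsc_ne _ hα₀R l j hl.symm
    have hnn : ∀ i, 0 ≤ c (α₀ - (Q α₀ l : ℝ) • α l) i := by
      rcases hbase _ (hsR _ hα₀R l) with hb | hb
      · exact hb
      · have := hb j
        omega
    have hmin := hα₀min _ ⟨hsR _ hα₀R l, hnn⟩ (hcj.trans hα₀j)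
    simp only [hsc _ hα₀R, Finset.sum_sub_distrib, Finset.sum_ite_eq', Finset.mem_univ,
      if_true] at hmin
    omega
  refine corootCoeff_le_one_of_pairing_nonpos R α c cv P Q (fun i β => β - (Q β i : ℝ) • α i)
    ?_ ?_ ?_ ?_ ?_ ?_ ?_ hsR ?_ hsc_ne ?_ ?_ ?_ ((∑ i, c α₀ i).toNat + 1) α₀ hα₀R hα₀nn ?_ j h1
    (hα₀j ▸ haj) ?_
  · intro i
    rw [hcα, if_pos rfl]
  · intro i l
    have h := hcvn _ (hα i) l
    rw [hcα] at h
    by_cases hl : l = i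
    · subst hl
      rw [if_pos rfl, Int.cast_one] at h
      have := mul_right_cancel₀ (hαpos l).ne' h
      exact_mod_cast this.le
    · rw [if_neg hl, Int.cast_zero, zero_mul] at h
      have := (mul_eq_zero.1 h).resolve_right (hαpos i).ne'
      have : cv (α i) l = 0 := by exact_mod_cast this
      omega
  · intro β hβ
    have h : (∑ i, (c β i : ℝ) * P β i) * ⟪β, β⟫ = 2 * ⟪β, β⟫ := by
      conv_rhs => rw [hc β hβ, inner_sum, ← hc β hβ]
      rw [Finset.sum_mul, Finset.mul_sum]
      refine Finset.sum_congr rfl fun i _ => ?_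
      rw [mul_assoc, hP' β hβ, inner_smul_right]
      ring
    have := mul_right_cancel₀ (hRpos β hβ).ne' h
    exact_mod_cast this
  · intro β hβ i
    have h : (c β i : ℝ) * P β i * ⟪β, β⟫ = cv β i * Q β i * ⟪β, β⟫ := by
      linear_combination (c β i : ℝ) * hP' β hβ i - (c β i : ℝ) * hQ' β hβ i
        - (Q β i : ℝ) * hcvn β hβ i
    have := mul_right_cancel₀ (hRpos β hβ).ne' h
    exact_mod_cast this
  · intro β hβ i
    rw [hPpos β hβ, hQpos β hβ]
  · intro β hβ i
    rw [← Int.cast_pos (R := ℝ), ← mul_pos_iff_of_pos_right (hαpos i), ← hcvn β hβ,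
      mul_pos_iff_of_pos_right (hRpos β hβ), Int.cast_pos]
  · intro β hβ hnn i
    by_contra! hcon
    obtain ⟨hne, h4⟩ := hcon
    have h4' : (4 : ℝ) ≤ P β i * Q β i := by exact_mod_cast h4
    have h5 : ((P β i : ℝ) * ⟪β, β⟫) * (Q β i * ⟪α i, α i⟫) = (2 * ⟪β, α i⟫) * (2 * ⟪β, α i⟫) := by
      rw [hP' β hβ, hQ' β hβ]
    have h6 : ⟪β, β⟫ * ⟪α i, α i⟫ ≤ ⟪β, α i⟫ * ⟪β, α i⟫ := by
      have := mul_le_mul_of_nonneg_right h4' (mul_pos (hRpos β hβ) (hαpos i)).le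
      linarith
    have hzero : β - (⟪β, α i⟫ / ⟪α i, α i⟫) • α i = 0 := by
      rw [← real_inner_self_nonpos]
      simp only [inner_sub_left, inner_sub_right, inner_smul_left, inner_smul_right,
        RCLike.conj_to_real, real_inner_comm β (α i)]
      have hp := hαpos i
      have : ⟪β, β⟫ ≤ ⟪β, α i⟫ * ⟪β, α i⟫ / ⟪α i, α i⟫ := (le_div_iff₀ hp).2 h6
      have h7 : ⟪β, α i⟫ / ⟪α i, α i⟫ * (⟪β, α i⟫ / ⟪α i, α i⟫ * ⟪α i, α i⟫)
        = ⟪β, α i⟫ * ⟪β, α i⟫ / ⟪α i, α i⟫ := by field_simp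
      have h8 : ⟪β, α i⟫ / ⟪α i, α i⟫ * ⟪β, α i⟫ = ⟪β, α i⟫ * ⟪β, α i⟫ / ⟪α i, α i⟫ := by
        ring
      linarith
    rw [sub_eq_zero] at hzero
    rcases hRred (α i) (hα i) (⟪β, α i⟫ / ⟪α i, α i⟫) (hzero ▸ hβ) with h | h
    · rw [h, one_smul] at hzero
      exact hne hzero
    · have := hcoef β hβ (fun l => if l = i then -1 else 0) (by
        rw [h] at hzero
        simpa using hzero) i
      rw [if_pos rfl] at this
      have h9 : c β i = -1 := by exact_mod_cast this
      have := hnn i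
      omega
  · intro β hβ i
    rw [hsc β hβ, if_pos rfl]
  · intro β hβ i l hl
    have h := hcvn _ (hsR β hβ i) l
    rw [hsn β hβ, hsc_ne β hβ i l hl, ← hcvn β hβ] at h
    have := mul_right_cancel₀ (hRpos β hβ).ne' h
    exact_mod_cast this
  · intro β hβ i l
    have h : (Q (β - (Q β i : ℝ) • α i) l : ℝ) * ⟪α l, α l⟫
        = (Q β l - Q β i * Q (α i) l) * ⟪α l, α l⟫ := by
      rw [hQ' _ (hsR β hβ i), sub_mul, mul_assoc, hQ' β hβ, hQ' _ (hα i), inner_sub_left,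
        real_inner_smul_left]
      ring
    have := mul_right_cancel₀ (hαpos l).ne' h
    exact_mod_cast this
  · intro i l hil
    by_contra! h
    exact (hA i l hil).not_gt ((hQpos _ (hα i) l).1 h)
  · have := Int.self_le_toNat (∑ i, c α₀ i)
    push_cast
    omega
  · intro l hl _
    by_contra! h
    exact (hneg l hl).not_gt ((hQpos _ hα₀R l).1 h)
end

section
/- For every α ∈ R^+ there exists an element w of the subgroup W_0 of the Weyl group of R generated by the reflections s_β with β ∈ R_0, such that −w(α) ∈ R^+ and w(α) = −Σ_{δ ∈ Δ_0} r_δ δ with rational coefficients r_δ ≥ 0, where Δ_0 = {α_i : i ≠ j} ∪ {α_0}. -/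
open RealInnerProductSpace

/-- In a family of vectors with pairwise non-acute angles lying strictly on one side of a hyperplane,
every combination that has non-negative inner product with each member has non-negative
coefficients. -/
theorem coeff_nonneg_of_inner_nonneg {V ι : Type*} [NormedAddCommGroup V] [InnerProductSpace ℝ V]
    [Fintype ι] (b : ι → V) (f : V →ₗ[ℝ] ℝ) (hf : ∀ i, 0 < f (b i))
    (hb : ∀ i k, i ≠ k → ⟪b i, b k⟫ ≤ 0) (x : ι → ℝ)
    (hx : ∀ i, 0 ≤ ⟪∑ k, x k • b k, b i⟫) (i : ι) : 0 ≤ x i := by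
  set y : ι → ℝ := fun i => max (-x i) 0 with hy
  have hy0 : ∀ i, 0 ≤ y i := fun i => le_max_right _ _
  have key : ∀ i, y i * ⟪∑ k, y k • b k, b i⟫ ≤ 0 := by
    intro i
    rcases (hy0 i).eq_or_lt with h | h
    · simp [← h]
    · refine mul_nonpos_of_nonneg_of_nonpos h.le ?_
      have hxi : x i + y i = 0 := by
        have : 0 < -x i := by simpa [hy] using h
        simp [hy, max_eq_left this.le]
      have hsum : ⟪∑ k, (x k + y k) • b k, b i⟫ ≤ 0 := by
        rw [sum_inner]
        refine Finset.sum_nonpos fun k _ => ?_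
        rw [real_inner_smul_left]
        rcases eq_or_ne k i with rfl | hki
        · simp [hxi]
        · refine mul_nonpos_of_nonneg_of_nonpos ?_ (hb k i hki)
          have : -x k ≤ y k := le_max_left _ _
          linarith
      have hxi' := hx i
      simp only [add_smul, Finset.sum_add_distrib, inner_add_left] at hsum
      linarith
  have hp : ∑ k, y k • b k = 0 := by
    refine inner_self_eq_zero (𝕜 := ℝ) |>.1 (le_antisymm ?_ real_inner_self_nonneg)
    change ⟪∑ k, y k • b k, ∑ k, y k • b k⟫ ≤ 0
    rw [inner_sum]
    refine Finset.sum_nonpos fun k _ => ?_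
    rw [real_inner_smul_right]
    exact key k
  have hfp : ∑ k, y k * f (b k) = 0 := by
    simpa using congrArg f hp
  have hyi := (Finset.sum_eq_zero_iff_of_nonneg
    (fun k _ => mul_nonneg (hy0 k) (hf k).le)).1 hfp i (Finset.mem_univ i)
  have : y i = 0 := (mul_eq_zero.1 hyi).resolve_right (hf i).ne'
  have h' : -x i ≤ y i := le_max_left _ _
  linarith

/-- The reflection in a non-zero vector is a linear automorphism. -/
theorem exists_linearEquiv_eq_reflection {V : Type*} [NormedAddCommGroup V]
    [InnerProductSpace ℝ V] {β : V} (hβ : β ≠ 0) :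
    ∃ u : V ≃ₗ[ℝ] V, ∀ v, u v = v - (2 * ⟪v, β⟫ / ⟪β, β⟫) • β := by
  have hββ : ⟪β, β⟫ ≠ 0 := inner_self_ne_zero.2 hβ
  have h : ((2 / ⟪β, β⟫) • (innerₗ V β)) β = 2 := by
    simp only [LinearMap.smul_apply, innerₗ_apply_apply, smul_eq_mul]
    field_simp
  refine ⟨Module.reflection h, fun v => ?_⟩
  rw [Module.reflection_apply]
  simp only [LinearMap.smul_apply, innerₗ_apply_apply, smul_eq_mul, real_inner_comm v β]
  congr 2
  ring

/-- For every α ∈ R⁺ there is an element w of the subgroup W₀ of the Weyl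
group generated by the reflections s_β, β ∈ R₀, with −w(α) ∈ R⁺ and
w(α) = −Σ_{δ ∈ Δ₀} r_δ δ with rational coefficients r_δ ≥ 0, where Δ₀ = {α_i : i ≠ j} ∪ {α₀}. -/
theorem statement8
    {V : Type*} [NormedAddCommGroup V] [InnerProductSpace ℝ V] [FiniteDimensional ℝ V]
    (R : Set V) (hRfin : R.Finite) (hR0 : (0 : V) ∉ R)
    (hRspan : Submodule.span ℝ R = ⊤)
    (hRneg : ∀ β ∈ R, -β ∈ R)
    (hRrefl : ∀ β ∈ R, ∀ γ ∈ R, γ - (2 * ⟪γ, β⟫ / ⟪β, β⟫) • β ∈ R)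
    (hRcrys : ∀ β ∈ R, ∀ γ ∈ R, ∃ k : ℤ, 2 * ⟪γ, β⟫ / ⟪β, β⟫ = (k : ℝ))
    (hRred : ∀ β ∈ R, ∀ s : ℝ, s • β ∈ R → s = 1 ∨ s = -1)
    (hRirr : ∀ R₁ R₂ : Set V, R = R₁ ∪ R₂ → (∀ a ∈ R₁, ∀ b ∈ R₂, ⟪a, b⟫ = 0) →
      R₁ = ∅ ∨ R₂ = ∅)
    (n : ℕ) (α : Fin n → V) (hα : ∀ i, α i ∈ R)
    (hαind : LinearIndependent ℝ α)
    (c : V → Fin n → ℤ)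
    (hc : ∀ β ∈ R, β = ∑ i, (c β i : ℝ) • α i)
    (hbase : ∀ β ∈ R, (∀ i, 0 ≤ c β i) ∨ (∀ i, c β i ≤ 0))
    (Rpos : Set V) (hRpos : Rpos = {β ∈ R | ∀ i, 0 ≤ c β i})
    (θ : V) (hθ : θ ∈ R) (hθhigh : ∀ β ∈ R, ∀ i, c β i ≤ c θ i)
    (j : Fin n) (haj : 2 ≤ c θ j)
    (R₀ : Set V)
    (hR₀ : R₀ = {β ∈ R | c β j = 0 ∨ c β j = c θ j ∨ c β j = -(c θ j)})
    (α₀ : V) (hα₀pos : α₀ ∈ Rpos) (hα₀j : c α₀ j = c θ j)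
    (hα₀min : ∀ β ∈ Rpos, c β j = c θ j → ∑ i, c α₀ i ≤ ∑ i, c β i) :
    ∀ γ ∈ Rpos, ∃ w : V ≃ₗ[ℝ] V,
      w ∈ Subgroup.closure
          {u : V ≃ₗ[ℝ] V | ∃ β ∈ R₀, ∀ v, u v = v - (2 * ⟪v, β⟫ / ⟪β, β⟫) • β} ∧
      -(w γ) ∈ Rpos ∧
      ∃ r : Fin n → ℚ, (∀ i, 0 ≤ r i) ∧
        w γ = -∑ i, (r i : ℝ) • (if i = j then α₀ else α i) := by
  have hne : ∀ β ∈ R, β ≠ 0 := fun β hβ h => hR0 (h ▸ hβ)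
  have hsub : ∀ β ∈ R, ∀ γ ∈ R, 0 < ⟪γ, β⟫ → ∃ k : ℝ, 0 < k ∧ γ - k • β ∈ R := by
    intro β hβ γ hγ h
    have : 0 < ⟪β, β⟫ := real_inner_self_pos.2 (hne β hβ)
    exact ⟨_, by positivity, hRrefl β hβ γ hγ⟩
  have hspan : ⊤ ≤ Submodule.span ℝ (Set.range α) := by
    rw [← hRspan, Submodule.span_le]
    intro β hβ
    rw [hc β hβ]
    exact Submodule.sum_mem _ fun i _ =>
      Submodule.smul_mem _ _ (Submodule.subset_span (Set.mem_range_self i))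
  set B := Module.Basis.mk hαind hspan with hB
  have hBα : ∀ i, B i = α i := fun i => by simp [hB]
  have hcB : ∀ β ∈ R, ∀ i, (c β i : ℝ) = B.coord i β := by
    intro β hβ i
    conv_rhs => rw [hc β hβ]
    simp only [← hBα, map_sum, map_smul, Module.Basis.coord_apply, Module.Basis.repr_self]
    simp [Finsupp.single_apply]
  have hcoordα : ∀ i k, B.coord i (α k) = if k = i then 1 else 0 := by
    intro i k
    rw [← hBα, Module.Basis.coord_apply, Module.Basis.repr_self, Finsupp.single_apply]
  set ht : V →ₗ[ℝ] ℝ := ∑ i, B.coord i with hht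
  have htR : ∀ β ∈ R, ht β = ((∑ i, c β i : ℤ) : ℝ) := by
    intro β hβ
    push_cast
    simp only [hht, LinearMap.sum_apply]
    exact Finset.sum_congr rfl fun i _ => (hcB β hβ i).symm
  have htα : ∀ i, ht (α i) = 1 := by
    intro i
    simp [hht, LinearMap.sum_apply, hcoordα]
  have hpos : ∀ β ∈ R, ∀ i, 0 < B.coord i β → ∀ k, 0 ≤ B.coord k β := by
    intro β hβ i hi k
    rw [← hcB β hβ] at hi ⊢
    rcases hbase β hβ with h | h
    · exact_mod_cast h k
    · exact absurd (h i) (not_le.2 (by exact_mod_cast hi))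
  have hmemRpos : ∀ β, β ∈ Rpos ↔ β ∈ R ∧ ∀ k, 0 ≤ B.coord k β := by
    intro β
    rw [hRpos]
    refine and_congr_right fun hβ => forall_congr' fun k => ?_
    rw [← hcB β hβ]
    exact Int.cast_nonneg_iff.symm
  obtain ⟨hα₀, hα₀nn⟩ := (hmemRpos α₀).1 hα₀pos
  have hajR : (0 : ℝ) < c θ j := by exact_mod_cast (by omega : 0 < c θ j)
  have hα₀c : B.coord j α₀ = c θ j := by rw [← hcB α₀ hα₀, hα₀j]
  set b : Fin n → V := fun i => if i = j then α₀ else α i with hb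
  have hbj : b j = α₀ := by simp [hb]
  have hbi : ∀ i, i ≠ j → b i = α i := fun i hi => by simp [hb, hi]
  have hbR : ∀ i, b i ∈ R := by
    intro i
    rcases eq_or_ne i j with rfl | hi
    · rwa [hbj]
    · rw [hbi i hi]; exact hα i
  have hbR₀ : ∀ i, b i ∈ R₀ := by
    intro i
    rw [hR₀]
    refine ⟨hbR i, ?_⟩
    rcases eq_or_ne i j with rfl | hi
    · rw [hbj]; exact Or.inr (Or.inl hα₀j)
    · refine Or.inl ?_
      have := hcB (b i) (hbR i) j
      rw [hbi i hi, hcoordα, if_neg hi] at this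
      rw [hbi i hi]
      exact_mod_cast this
  have hbnn : ∀ i k, 0 ≤ B.coord k (b i) := by
    intro i k
    rcases eq_or_ne i j with rfl | hi
    · rw [hbj]; exact hα₀nn k
    · rw [hbi i hi, hcoordα]; split_ifs <;> norm_num
  have htb : ∀ i, 0 < ht (b i) := by
    intro i
    rcases eq_or_ne i j with rfl | hi
    · rw [hbj, hht, LinearMap.sum_apply]
      exact Finset.sum_pos' (fun k _ => hα₀nn k) ⟨i, Finset.mem_univ i, by rw [hα₀c]; exact hajR⟩
    · rw [hbi i hi, htα]; exact one_pos
  have hα₀obt : ∀ i, i ≠ j → ⟪α₀, α i⟫ ≤ 0 := by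
    intro i hi
    by_contra! h
    obtain ⟨k, hk, hkR⟩ := hsub (α i) (hα i) α₀ hα₀ h
    have hcj : B.coord j (α₀ - k • α i) = c θ j := by
      rw [map_sub, map_smul, hcoordα, if_neg hi, hα₀c]; simp
    have hkpos : α₀ - k • α i ∈ Rpos :=
      (hmemRpos _).2 ⟨hkR, hpos _ hkR j (hcj ▸ hajR)⟩
    have hmin := hα₀min _ hkpos (by rw [← hcB _ hkR] at hcj; exact_mod_cast hcj)
    have hmin' : ht α₀ ≤ ht (α₀ - k • α i) := by
      rw [htR _ hα₀, htR _ hkR]; exact_mod_cast hmin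
    rw [map_sub, map_smul, htα, smul_eq_mul] at hmin'
    linarith
  have hαobt : ∀ i k, i ≠ k → ⟪α i, α k⟫ ≤ 0 := by
    intro i k hik
    by_contra! h
    obtain ⟨t, ht0, htR'⟩ := hsub (α k) (hα k) (α i) (hα i) h
    have h1 := hpos _ htR' i (by
      rw [map_sub, map_smul, hcoordα, hcoordα, if_pos rfl, if_neg hik.symm]; simp) k
    rw [map_sub, map_smul, hcoordα, hcoordα, if_pos rfl, if_neg hik, smul_eq_mul] at h1
    linarith
  have hbobt : ∀ i k, i ≠ k → ⟪b i, b k⟫ ≤ 0 := by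
    intro i k hik
    rcases eq_or_ne i j with rfl | hi
    · rw [hbj, hbi k hik.symm]; exact hα₀obt k hik.symm
    · rcases eq_or_ne k j with rfl | hk
      · rw [hbj, hbi i hi, real_inner_comm]; exact hα₀obt i hi
      · rw [hbi i hi, hbi k hk]; exact hαobt i k hik
  intro γ hγ
  set W := Subgroup.closure
    {u : V ≃ₗ[ℝ] V | ∃ β ∈ R₀, ∀ v, u v = v - (2 * ⟪v, β⟫ / ⟪β, β⟫) • β} with hW
  obtain ⟨v, ⟨hvR, w, hw, rfl⟩, hvmin⟩ := Set.exists_min_image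
    {v : V | v ∈ R ∧ ∃ w ∈ W, w γ = v} ht (hRfin.subset fun v hv => hv.1)
    ⟨γ, ((hmemRpos γ).1 hγ).1, 1, W.one_mem, rfl⟩
  have hanti : ∀ i, ⟪w γ, b i⟫ ≤ 0 := by
    intro i
    by_contra! h
    obtain ⟨u, hu⟩ := exists_linearEquiv_eq_reflection (hne _ (hbR i))
    have hle := hvmin (u (w γ)) ⟨by rw [hu]; exact hRrefl _ (hbR i) _ hvR, u * w,
      W.mul_mem (Subgroup.subset_closure ⟨b i, hbR₀ i, hu⟩) hw, rfl⟩
    have hbb : 0 < ⟪b i, b i⟫ := real_inner_self_pos.2 (hne _ (hbR i))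
    rw [hu, map_sub, map_smul, smul_eq_mul] at hle
    have : 0 < 2 * ⟪w γ, b i⟫ / ⟪b i, b i⟫ * ht (b i) :=
      mul_pos (by positivity) (htb i)
    linarith
  have hβR : -(w γ) ∈ R := hRneg _ hvR
  set β := -(w γ) with hβ
  set r : Fin n → ℚ := fun i =>
    if i = j then (c β j : ℚ) / c θ j else c β i - (c β j : ℚ) / c θ j * c α₀ i with hr
  have hexp : β = ∑ i, (r i : ℝ) • b i := by
    have hsplit : ∑ i, (r i : ℝ) • b i =
        ((c β j : ℝ) / c θ j) • α₀ +
          ∑ i ∈ Finset.univ.erase j,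
            ((c β i : ℝ) - (c β j : ℝ) / c θ j * c α₀ i) • α i := by
      rw [← Finset.add_sum_erase _ _ (Finset.mem_univ j), hbj]
      congr 1
      · simp [hr]
      · refine Finset.sum_congr rfl fun i hi => ?_
        have hi' := Finset.ne_of_mem_erase hi
        rw [hbi i hi']
        simp [hr, hi']
    have hfull : ∑ i ∈ Finset.univ.erase j,
        ((c β i : ℝ) - (c β j : ℝ) / c θ j * c α₀ i) • α i =
        ∑ i, ((c β i : ℝ) - (c β j : ℝ) / c θ j * c α₀ i) • α i := by
      refine Finset.sum_erase _ ?_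
      rw [hα₀j, div_mul_cancel₀ _ hajR.ne', sub_self, zero_smul]
    rw [hsplit, hfull]
    simp only [sub_smul, mul_smul, Finset.sum_sub_distrib, ← Finset.smul_sum]
    rw [← hc β hβR, ← hc α₀ hα₀]
    abel
  have hrnn : ∀ i, (0 : ℝ) ≤ r i := by
    refine coeff_nonneg_of_inner_nonneg b ht htb hbobt (fun i => (r i : ℝ)) fun i => ?_
    rw [← hexp, hβ, inner_neg_left]
    linarith [hanti i]
  refine ⟨w, hw, (hmemRpos _).2 ⟨hβR, fun k => ?_⟩, r, fun i => by exact_mod_cast hrnn i, ?_⟩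
  · change 0 ≤ B.coord k β
    rw [hexp, map_sum]
    refine Finset.sum_nonneg fun i _ => ?_
    rw [map_smul, smul_eq_mul]
    exact mul_nonneg (hrnn i) (hbnn i k)
  · rw [← neg_eq_iff_eq_neg]
    exact hexp
end

section
/- The image of L under ev_0 equals g_0 = g^τ, and for every z ∈ ℂ with z ≠ 0 the image of L under ev_z equals all of g. -/
open scoped TensorProduct

/-- There is a polynomial with value `1` at `z ≠ 0` and value `0` at the other points of the orbit
of `z` under multiplication by a primitive `m`-th root of unity. -/
theorem exists_polynomial_eval_orbit {m : ℕ} {ζ : ℂ} (hζ : IsPrimitiveRoot ζ m)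
    {z : ℂ} (hz : z ≠ 0) :
    ∃ p : Polynomial ℂ, ∀ j < m, p.eval (ζ ^ j * z) = if j = 0 then 1 else 0 := by
  have hinj : Set.InjOn (fun j : ℕ => ζ ^ j * z) (Finset.range m) := by
    intro i hi j hj h
    exact hζ.pow_inj (by simpa using hi) (by simpa using hj) (mul_right_cancel₀ hz h)
  refine ⟨Lagrange.basis (Finset.range m) (fun j => ζ ^ j * z) 0, fun j hj => ?_⟩
  split_ifs with h
  · subst h
    exact Lagrange.eval_basis_self hinj (Finset.mem_range.2 hj)
  · exact Lagrange.eval_basis_of_ne (v := fun j : ℕ => ζ ^ j * z) (Ne.symm h)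
      (Finset.mem_range.2 hj)

/-- For the fixed-point subalgebra L = (g ⊗ ℂ[t])^τ of the current algebra
under the automorphism τ(x ⊗ f(t)) = τ(x) ⊗ f(ζ⁻¹t), the image of L under ev₀ equals
g₀ = g^τ, and for every z ≠ 0 the image of L under ev_z is all of g. -/
theorem statement11
    {g : Type*} [LieRing g] [LieAlgebra ℂ g] [FiniteDimensional ℂ g]
    (m : ℕ) (hm : 1 ≤ m) (ζ : ℂ) (hζ : IsPrimitiveRoot ζ m)
    (τ : g →ₗ⁅ℂ⁆ g) (hτm : ∀ x, (⇑τ)^[m] x = x)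
    (τt : (Polynomial ℂ ⊗[ℂ] g) →ₗ[ℂ] (Polynomial ℂ ⊗[ℂ] g))
    (hτt : ∀ (f : Polynomial ℂ) (x : g),
      τt (f ⊗ₜ[ℂ] x) = (f.comp (Polynomial.C ζ⁻¹ * Polynomial.X)) ⊗ₜ[ℂ] (τ x))
    (hτtLie : ∀ a b : Polynomial ℂ ⊗[ℂ] g, τt ⁅a, b⁆ = ⁅τt a, τt b⁆)
    (Lfix : Submodule ℂ (Polynomial ℂ ⊗[ℂ] g))
    (hLfix : ∀ a, a ∈ Lfix ↔ τt a = a)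
    (ev : ℂ → (Polynomial ℂ ⊗[ℂ] g →ₗ[ℂ] g))
    (hev : ∀ (z : ℂ) (f : Polynomial ℂ) (x : g), ev z (f ⊗ₜ[ℂ] x) = f.eval z • x)
    (hevLie : ∀ (z : ℂ) (a b : Polynomial ℂ ⊗[ℂ] g), ev z ⁅a, b⁆ = ⁅ev z a, ev z b⁆)
    (g0 : Submodule ℂ g) (hg0 : ∀ x, x ∈ g0 ↔ τ x = x) :
    Submodule.map (ev 0) Lfix = g0 ∧
    ∀ z : ℂ, z ≠ 0 → Submodule.map (ev z) Lfix = ⊤ := by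
  refine ⟨le_antisymm ?_ ?_, fun z hz => ?_⟩
  · have hcomm : ∀ a, ev 0 (τt a) = τ (ev 0 a) := by
      intro a
      induction a using TensorProduct.induction_on with
      | zero => simp
      | tmul f x => simp [hτt, hev]
      | add a b ha hb => simp only [map_add, ha, hb]
    rintro _ ⟨a, ha, rfl⟩
    rw [hg0, ← hcomm, (hLfix a).1 ha]
  · intro x hx
    refine ⟨1 ⊗ₜ[ℂ] x, ?_, by simp [hev]⟩
    rw [SetLike.mem_coe, hLfix, hτt, (hg0 x).1 hx, Polynomial.one_comp]
  · rw [eq_top_iff]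
    intro x _
    obtain ⟨p, hp⟩ := exists_polynomial_eval_orbit hζ.inv hz
    let f : ℕ → Polynomial ℂ ⊗[ℂ] g := fun j =>
      p.comp (Polynomial.C (ζ⁻¹ ^ j) * Polynomial.X) ⊗ₜ[ℂ] ((⇑τ)^[j] x)
    have hf : ∀ j, τt (f j) = f (j + 1) := by
      intro j
      simp only [f, hτt, Polynomial.comp_assoc, Function.iterate_succ_apply']
      congr 2
      simp only [Polynomial.mul_comp, Polynomial.C_comp, Polynomial.X_comp, pow_succ,
        Polynomial.C_mul, mul_assoc]
    have hfm : f m = f 0 := by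
      simp only [f, hτm, hζ.inv.pow_eq_one, pow_zero, Function.iterate_zero_apply]
    refine ⟨∑ j ∈ Finset.range m, f j, ?_, ?_⟩
    · rw [SetLike.mem_coe, hLfix, map_sum, Finset.sum_congr rfl fun j _ => hf j]
      apply add_right_cancel (b := f 0)
      rw [← Finset.sum_range_succ', Finset.sum_range_succ, hfm]
    · rw [map_sum, Finset.sum_eq_single_of_mem 0 (Finset.mem_range.2 hm)]
      · simpa [f, hev] using congrArg (· • x) (hp 0 hm)
      · intro j hj h0
        have h := hp j (by simpa using hj)
        rw [if_neg h0] at h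
        simp only [f, hev, Polynomial.eval_comp, Polynomial.eval_mul, Polynomial.eval_C,
          Polynomial.eval_X, h, zero_smul]
end

section
/- Assume in addition that g is simple, m ≥ 2, some Cartan subalgebra h of g is fixed pointwise by τ, g_0 = span⁅g_1, g_{m−1}⁆, g_k = span⁅g_{k−l}, g_l⁆ for all 0 ≤ l < k ≤ m−1, and for each 1 ≤ k ≤ m−1 the g_0-module g_k (adjoint action) is irreducible with ⁅g_0, g_k⁆ = g_k. Then for every nonzero Lie ideal I of L there exist k ∈ {0, …, m−1} and a nonzero polynomial f ∈ ℂ[t^m] such that (g ⊗ t^k f ℂ[t^m])^τ ⊆ I; in particular, every nonzero Lie ideal I of L has finite codimension, i.e. the quotient L/I is finite-dimensional over ℂ. -/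
open scoped TensorProduct

section Density

variable (k : Type*) {L : Type*} [Field k] [IsAlgClosed k] [LieRing L] [LieAlgebra k L]
  [FiniteDimensional k L] [LieAlgebra.IsSimple k L]

/-- Burnside's theorem for the adjoint representation of a simple Lie algebra. -/
theorem LieAlgebra.adjoin_range_ad_eq_top :
    Algebra.adjoin k (Set.range (LieAlgebra.ad k L)) = ⊤ := by
  set A := Algebra.adjoin k (Set.range (LieAlgebra.ad k L))
  have : Nontrivial L := LieAlgebra.IsSimple.nontrivial k L
  have : IsSimpleModule A L := by
    refine { toIsSimpleOrder := IsSimpleOrder.of_forall_eq_top fun N hN ↦ ?_ }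
    let J : LieIdeal k L :=
      { N.restrictScalars k with
        lie_mem := fun {x y} hy ↦
          N.smul_mem ⟨LieAlgebra.ad k L x, Algebra.subset_adjoin ⟨x, rfl⟩⟩ hy }
    rcases LieAlgebra.IsSimple.eq_bot_or_eq_top (R := k) J with h | h
    · refine absurd ((Submodule.eq_bot_iff N).2 fun x hx ↦ ?_) hN
      have : x ∈ J := hx
      simpa [h] using this
    · refine (Submodule.eq_top_iff').2 fun x ↦ ?_
      have : x ∈ J := h ▸ LieSubmodule.mem_top x
      exact this
  refine (Algebra.eq_top_iff).2 fun f ↦ ?_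
  let F : Module.End (Module.End A L) L :=
    { f with
      map_smul' := fun e x ↦ by
        obtain ⟨c, rfl⟩ := (IsSimpleModule.algebraMap_end_bijective_of_isAlgClosed (A := A) k).2 e
        simp }
  have : Module.Finite (Module.End A L) L := Module.Finite.of_restrictScalars_finite k _ _
  obtain ⟨r, hr⟩ := Module.Finite.toModuleEnd_moduleEnd_surjective (R := A) (M := L) F
  have : f = r := LinearMap.ext fun x ↦ (LinearMap.congr_fun hr x).symm
  exact this ▸ r.2

variable {k} {A : Type*} [CommRing A] [IsDomain A] [Algebra k A]

/-- A nonzero `A`-submodule of `A ⊗ L` which is stable, up to a fixed nonzero factor, under the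
adjoint action of a simple Lie algebra `L` contains a nonzero multiple of `A ⊗ L`. -/
theorem LieAlgebra.exists_tmul_mem_of_lie_mem (K : Submodule A (A ⊗[k] L)) (hK : K ≠ ⊥) {c : A}
    (hc : c ≠ 0) (hcK : ∀ x : L, ∀ b ∈ K, ⁅c ⊗ₜ[k] x, b⁆ ∈ K) :
    ∃ h : A, h ≠ 0 ∧ ∀ x : L, h ⊗ₜ[k] x ∈ K := by
  have hbc : ∀ (x : L) (b : A ⊗[k] L),
      c • (LieAlgebra.ad k L x).baseChange A b = ⁅c ⊗ₜ[k] x, b⁆ := fun x b ↦ by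
    induction b with
    | zero => simp
    | tmul p y => simp [TensorProduct.smul_tmul']
    | add b b' h h' => rw [map_add, smul_add, lie_add, h, h']
  have mono : ∀ {f : Module.End k L} {i j : ℕ}, i ≤ j →
      (∀ b ∈ K, c ^ i • f.baseChange A b ∈ K) → ∀ b ∈ K, c ^ j • f.baseChange A b ∈ K := by
    intro f i j hij h b hb
    rw [← Nat.sub_add_cancel hij, pow_add, mul_smul]
    exact K.smul_mem _ (h b hb)
  have key : ∀ f : Module.End k L, ∃ N : ℕ, ∀ b ∈ K, c ^ N • f.baseChange A b ∈ K := by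
    intro f
    have hf : f ∈ Subalgebra.toSubmodule (Algebra.adjoin k (Set.range (LieAlgebra.ad k L))) := by
      rw [LieAlgebra.adjoin_range_ad_eq_top]; trivial
    rw [Algebra.adjoin_eq_span] at hf
    induction hf using Submodule.span_induction with
    | mem f hf =>
      induction hf using Submonoid.closure_induction_left with
      | one => exact ⟨0, fun b hb ↦ by simpa using hb⟩
      | mul_left g hg f hf ih =>
        obtain ⟨x, rfl⟩ := hg
        obtain ⟨N, hN⟩ := ih
        refine ⟨N + 1, fun b hb ↦ ?_⟩
        rw [LinearMap.baseChange_mul, Module.End.mul_apply, pow_succ', mul_smul, ← map_smul, hbc]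
        exact hcK _ _ (hN b hb)
    | zero => exact ⟨0, fun b _ ↦ by simp⟩
    | add f g _ _ hf hg =>
      obtain ⟨M, hM⟩ := hf
      obtain ⟨N, hN⟩ := hg
      refine ⟨max M N, fun b hb ↦ ?_⟩
      rw [LinearMap.baseChange_add, LinearMap.add_apply, smul_add]
      exact K.add_mem (mono (le_max_left _ _) hM b hb) (mono (le_max_right _ _) hN b hb)
    | smul a f _ hf =>
      obtain ⟨N, hN⟩ := hf
      refine ⟨N, fun b hb ↦ ?_⟩
      rw [LinearMap.baseChange_smul, LinearMap.smul_apply, smul_comm]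
      exact (K.restrictScalars k).smul_mem a (hN b hb)
  obtain ⟨b, hb, hb0⟩ := K.exists_mem_ne_zero_of_ne_bot hK
  let B := Module.finBasis k L
  obtain ⟨i, hi⟩ : ∃ i, (B.baseChange A).repr b i ≠ 0 := by
    by_contra! h
    exact hb0 ((B.baseChange A).repr.map_eq_zero_iff.1 (Finsupp.ext h))
  have hproj : ∀ (x : L) (a : A ⊗[k] L), ((B.coord i).smulRight x).baseChange A a =
      ((B.baseChange A).repr a i) ⊗ₜ[k] x := fun x a ↦ by
    induction a with
    | zero => simp
    | tmul p y => simp [TensorProduct.tmul_smul, TensorProduct.smul_tmul']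
    | add a a' h h' => simp [map_add, h, h', TensorProduct.add_tmul]
  choose N hN using fun j ↦ key ((B.coord i).smulRight (B j))
  let M := Finset.univ.sup N
  let h := c ^ M * (B.baseChange A).repr b i
  refine ⟨h, mul_ne_zero (pow_ne_zero _ hc) hi, fun x ↦ ?_⟩
  rw [← B.sum_repr x, TensorProduct.tmul_sum]
  refine K.sum_mem fun j _ ↦ ?_
  rw [TensorProduct.tmul_smul]
  refine (K.restrictScalars k).smul_mem _ ?_
  have := mono (Finset.le_sup (Finset.mem_univ j)) (hN j) b hb
  rwa [hproj, TensorProduct.smul_tmul', smul_eq_mul] at this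

/-- The current algebra `A ⊗ L` of a simple Lie algebra `L` has trivial centre. -/
theorem LieAlgebra.eq_zero_of_forall_one_tmul_lie_eq_zero {a : A ⊗[k] L}
    (ha : ∀ x : L, ⁅(1 : A) ⊗ₜ[k] x, a⁆ = 0) : a = 0 := by
  by_contra h0
  obtain ⟨h, hh, hmem⟩ := LieAlgebra.exists_tmul_mem_of_lie_mem (k := k) (A ∙ a) (by simpa)
    one_ne_zero fun x b hb ↦ by
      obtain ⟨p, rfl⟩ := Submodule.mem_span_singleton.1 hb
      simp [ha]
  refine LieAlgebra.IsSimple.non_abelian k (L := L) ⟨fun x y ↦ ?_⟩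
  obtain ⟨p, hp⟩ := Submodule.mem_span_singleton.1 (hmem y)
  have hz : h ⊗ₜ[k] ⁅x, y⁆ = 0 := by
    rw [← one_mul h, ← LieAlgebra.ExtendScalars.bracket_tmul, ← hp, lie_smul, ha, smul_zero]
  let B := Module.finBasis k L
  refine B.repr.map_eq_zero_iff.1 (Finsupp.ext fun i ↦ ?_)
  simpa [hh] using congrArg (fun a ↦ (B.baseChange A).repr a i) hz

end Density

section CyclicAverage

open Polynomial Finset

variable {V : Type*} [AddCommGroup V] [Module ℂ V]

/-- The average `(1 / m) ∑_{r < m} T ^ r` of the powers of an endomorphism `T`. -/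
noncomputable def Module.End.cyclicAverage (T : Module.End ℂ V) (m : ℕ) : Module.End ℂ V :=
  (m : ℂ)⁻¹ • ∑ r ∈ range m, T ^ r

theorem Module.End.cyclicAverage_apply (T : Module.End ℂ V) (m : ℕ) (a : V) :
    T.cyclicAverage m a = (m : ℂ)⁻¹ • ∑ r ∈ range m, (T ^ r) a := by
  simp [cyclicAverage]

theorem Module.End.apply_cyclicAverage {T : Module.End ℂ V} {m : ℕ} (hT : T ^ m = 1) (a : V) :
    T (T.cyclicAverage m a) = T.cyclicAverage m a := by
  have h : ∑ r ∈ range m, (T ^ (r + 1)) a = ∑ r ∈ range m, (T ^ r) a := by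
    apply add_right_cancel (b := (T ^ 0) a)
    rw [← sum_range_succ' (fun r ↦ (T ^ r) a), sum_range_succ, hT, pow_zero]
  rw [cyclicAverage_apply, map_smul, map_sum, ← h]
  simp only [h, ← Module.End.mul_apply, ← pow_succ']

theorem Module.End.pow_apply_eq_self {T : Module.End ℂ V} {a : V} (ha : T a = a) (r : ℕ) :
    (T ^ r) a = a := by
  rw [Module.End.pow_apply, Function.iterate_fixed ha]

theorem Module.End.cyclicAverage_of_apply_eq_self {T : Module.End ℂ V} {m : ℕ} (hm : m ≠ 0)
    {a : V} (ha : T a = a) : T.cyclicAverage m a = a := by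
  simp [cyclicAverage_apply, pow_apply_eq_self ha, ← Nat.cast_smul_eq_nsmul ℂ, smul_smul, hm]

variable [Module ℂ[X] V] {T : Module.End ℂ V}

theorem Module.End.pow_apply_polynomial_smul {ω : ℂ}
    (hT : ∀ (p : ℂ[X]) (a : V), T (p • a) = p.comp (C ω * X) • T a) (r : ℕ) (p : ℂ[X]) (a : V) :
    (T ^ r) (p • a) = p.comp (C (ω ^ r) * X) • (T ^ r) a := by
  induction r with
  | zero => simp
  | succ r ih =>
    rw [pow_succ', Module.End.mul_apply, ih, hT, Module.End.mul_apply, comp_assoc]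
    simp [pow_succ, mul_assoc]

/-- If `T` is semilinear over `t ↦ ω t`, every element of `V` can be recovered, up to a power
of `t`, from the averages of its multiples. -/
theorem Module.End.sum_X_pow_smul_cyclicAverage [IsScalarTower ℂ ℂ[X] V] {ω : ℂ} {m : ℕ}
    (hω : IsPrimitiveRoot ω m) (hm : m ≠ 0)
    (hT : ∀ (p : ℂ[X]) (a : V), T (p • a) = p.comp (C ω * X) • T a) (a : V) :
    ∑ j ∈ range m, (X ^ (m - j) : ℂ[X]) • T.cyclicAverage m ((X ^ j : ℂ[X]) • a) =
      (X ^ m : ℂ[X]) • a := by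
  have hterm : ∀ j ∈ range m,
      (X ^ (m - j) : ℂ[X]) • T.cyclicAverage m ((X ^ j : ℂ[X]) • a) =
        ∑ r ∈ range m, (m : ℂ)⁻¹ • ((ω ^ r) ^ j) • ((X ^ m : ℂ[X]) • (T ^ r) a) := by
    intro j hj
    rw [cyclicAverage_apply, smul_comm, smul_sum, smul_sum]
    refine sum_congr rfl fun r _ ↦ ?_
    rw [pow_apply_polynomial_smul hT, X_pow_comp, mul_pow, ← C_pow, smul_smul, mul_left_comm,
      ← pow_add, Nat.sub_add_cancel (mem_range.1 hj).le, ← smul_eq_C_mul, smul_assoc]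
  rw [sum_congr rfl hterm, sum_comm]
  have hgeom : ∀ r ∈ range m, r ≠ 0 → ∑ j ∈ range m, (ω ^ r) ^ j = 0 := by
    intro r hr hr0
    have h1 : ω ^ r - 1 ≠ 0 := sub_ne_zero.2 (hω.pow_ne_one_of_pos_of_lt hr0 (mem_range.1 hr))
    refine (mul_eq_zero.1 ?_).resolve_left h1
    rw [mul_geom_sum, ← pow_mul, mul_comm, pow_mul, hω.pow_eq_one, one_pow, sub_self]
  rw [sum_eq_single_of_mem 0 (mem_range.2 (Nat.pos_of_ne_zero hm)) fun r hr hr0 ↦ by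
    rw [← smul_sum, ← sum_smul, hgeom r hr hr0, zero_smul, smul_zero]]
  rw [← smul_sum, ← sum_smul, smul_smul]
  simp [hm]

end CyclicAverage

/-- Every nonzero polynomial divides a nonzero polynomial in `X ^ m`. -/
theorem Polynomial.exists_dvd_comp_X_pow {k : Type*} [Field k] {h : Polynomial k} (hh : h ≠ 0)
    {m : ℕ} (hm : m ≠ 0) :
    ∃ q : Polynomial k, q.comp (X ^ m) ≠ 0 ∧ h ∣ q.comp (X ^ m) := by
  have : Module.Finite k (AdjoinRoot h) := (AdjoinRoot.powerBasis hh).finite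
  have hint : IsIntegral k (AdjoinRoot.mk h (X ^ m)) := Algebra.IsIntegral.isIntegral _
  refine ⟨minpoly k (AdjoinRoot.mk h (X ^ m)), ?_, ?_⟩
  · rw [← expand_eq_comp_X_pow, Ne, expand_eq_zero (Nat.pos_of_ne_zero hm)]
    exact minpoly.ne_zero hint
  · rw [← AdjoinRoot.mk_eq_zero, ← AdjoinRoot.aeval_eq, aeval_comp, map_pow, aeval_X]
    simp

/-- Modulo `h`, the module `k[X] ⊗ V` is spanned by the finite-dimensional space of elements of
degree less than `h.natDegree`. -/
theorem Polynomial.exists_fg_sup_eq_top {k V : Type*} [Field k] [AddCommGroup V] [Module k V]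
    [FiniteDimensional k V] {h : Polynomial k} (hh : h ≠ 0)
    (K : Submodule (Polynomial k) (Polynomial k ⊗[k] V)) (hK : ∀ x : V, h ⊗ₜ[k] x ∈ K) :
    ∃ W : Submodule k (Polynomial k ⊗[k] V), W.FG ∧ W ⊔ K.restrictScalars k = ⊤ := by
  classical
  refine ⟨Submodule.map₂ (TensorProduct.mk k _ V) (degreeLT k h.natDegree) ⊤,
    Submodule.FG.map₂ _ (by rw [degreeLT_eq_span_X_pow]; exact ⟨_, rfl⟩)
      Module.Finite.fg_top, ?_⟩
  rw [eq_top_iff, ← TensorProduct.span_tmul_eq_top, Submodule.span_le]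
  rintro _ ⟨p, x, rfl⟩
  rw [← EuclideanDomain.mod_add_div p h, TensorProduct.add_tmul]
  refine Submodule.add_mem_sup (Submodule.apply_mem_map₂ _ ?_ trivial) ?_
  · rw [mem_degreeLT, ← degree_eq_natDegree hh]
    exact degree_mod_lt p hh
  · rw [mul_comm, ← smul_eq_mul, ← TensorProduct.smul_tmul']
    exact K.smul_mem _ (hK x)

/-- Under the stated hypotheses on (g, τ, m), every nonzero Lie ideal I of
L = (g ⊗ ℂ[t])^τ contains (g ⊗ t^k f ℂ[t^m])^τ for some 0 ≤ k < m and some nonzero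
f ∈ ℂ[t^m]; in particular every nonzero Lie ideal of L has finite codimension, i.e. the quotient
L/I — realized as the image of L in (g ⊗ ℂ[t])/I, since I ≤ L — is finite-dimensional
over ℂ. -/
theorem statement12
    {g : Type*} [LieRing g] [LieAlgebra ℂ g] [FiniteDimensional ℂ g]
    (m : ℕ) (hm : 1 ≤ m) (ζ : ℂ) (hζ : IsPrimitiveRoot ζ m)
    (τ : g →ₗ⁅ℂ⁆ g) (hτm : ∀ x, (⇑τ)^[m] x = x)
    (τt : (Polynomial ℂ ⊗[ℂ] g) →ₗ[ℂ] (Polynomial ℂ ⊗[ℂ] g))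
    (hτt : ∀ (f : Polynomial ℂ) (x : g),
      τt (f ⊗ₜ[ℂ] x) = (f.comp (Polynomial.C ζ⁻¹ * Polynomial.X)) ⊗ₜ[ℂ] (τ x))
    (hτtLie : ∀ a b : Polynomial ℂ ⊗[ℂ] g, τt ⁅a, b⁆ = ⁅τt a, τt b⁆)
    (Lfix : Submodule ℂ (Polynomial ℂ ⊗[ℂ] g))
    (hLfix : ∀ a, a ∈ Lfix ↔ τt a = a)
    [LieAlgebra.IsSimple ℂ g] (hm2 : 2 ≤ m)
    (H : LieSubalgebra ℂ g) [H.IsCartanSubalgebra] (hHfix : ∀ x ∈ H, τ x = x)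
    (gk : ℕ → Submodule ℂ g) (hgk : ∀ (k : ℕ) (x : g), x ∈ gk k ↔ τ x = ζ ^ k • x)
    (sb : Submodule ℂ g → Submodule ℂ g → Submodule ℂ g)
    (hsb : ∀ A B : Submodule ℂ g,
      sb A B = Submodule.span ℂ {z : g | ∃ x ∈ A, ∃ y ∈ B, z = ⁅x, y⁆})
    (hspan0 : gk 0 = sb (gk 1) (gk (m - 1)))
    (hspank : ∀ l k : ℕ, l < k → k ≤ m - 1 → gk k = sb (gk (k - l)) (gk l))
    (hirr : ∀ k : ℕ, 1 ≤ k → k ≤ m - 1 →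
      gk k ≠ ⊥ ∧
      (∀ W : Submodule ℂ g, W ≤ gk k →
        (∀ x ∈ gk 0, ∀ w ∈ W, ⁅x, w⁆ ∈ W) → W = ⊥ ∨ W = gk k) ∧
      sb (gk 0) (gk k) = gk k)
    : ∀ I : Submodule ℂ (Polynomial ℂ ⊗[ℂ] g), I ≤ Lfix →
      (∀ a ∈ Lfix, ∀ b ∈ I, ⁅a, b⁆ ∈ I) → I ≠ ⊥ →
      (∃ k : ℕ, k < m ∧ ∃ f : Polynomial ℂ, f ≠ 0 ∧
        (∃ q : Polynomial ℂ, f = q.comp (Polynomial.X ^ m)) ∧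
        (Submodule.span ℂ {a : Polynomial ℂ ⊗[ℂ] g | ∃ (q : Polynomial ℂ) (x : g),
            a = (Polynomial.X ^ k * f * q.comp (Polynomial.X ^ m)) ⊗ₜ[ℂ] x} ⊓ Lfix) ≤ I) ∧
      FiniteDimensional ℂ ↥(Lfix.map I.mkQ) := by
  intro I hIL hI hI0
  have hm0 : m ≠ 0 := Nat.ne_of_gt hm
  have hsemi : ∀ (p : Polynomial ℂ) (a : Polynomial ℂ ⊗[ℂ] g),
      τt (p • a) = p.comp (Polynomial.C ζ⁻¹ * Polynomial.X) • τt a := fun p a ↦ by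
    induction a with
    | zero => simp
    | tmul f x => simp [TensorProduct.smul_tmul', hτt]
    | add a b ha hb => rw [smul_add, map_add, ha, hb, map_add, smul_add]
  have hpow : τt ^ m = 1 := by
    have hr : ∀ (r : ℕ) (x : g), (τt ^ r) (1 ⊗ₜ[ℂ] x) = 1 ⊗ₜ[ℂ] (⇑τ)^[r] x := fun r x ↦ by
      induction r with
      | zero => rfl
      | succ r ih => rw [pow_succ', Module.End.mul_apply, ih, hτt, Polynomial.one_comp,
          Function.iterate_succ_apply']
    refine TensorProduct.ext' fun f x ↦ ?_
    rw [← mul_one f, ← smul_eq_mul, ← TensorProduct.smul_tmul',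
      Module.End.pow_apply_polynomial_smul hsemi, hr, hτm, hζ.inv.pow_eq_one]
    simp
  have hsmul_lie : ∀ (p : Polynomial ℂ) (a b : Polynomial ℂ ⊗[ℂ] g), ⁅p • a, b⁆ = p • ⁅a, b⁆ :=
    fun p a b ↦ smul_lie p a b
  have hlie_smul : ∀ (p : Polynomial ℂ) (a b : Polynomial ℂ ⊗[ℂ] g), ⁅a, p • b⁆ = p • ⁅a, b⁆ :=
    fun p a b ↦ lie_smul p a b
  have hlie_skew : ∀ a b : Polynomial ℂ ⊗[ℂ] g, -⁅b, a⁆ = ⁅a, b⁆ := fun a b ↦ lie_skew a b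
  have hsum_lie : ∀ (v : ℕ → Polynomial ℂ ⊗[ℂ] g) (b : Polynomial ℂ ⊗[ℂ] g),
      ⁅∑ r ∈ Finset.range m, v r, b⁆ = ∑ r ∈ Finset.range m, ⁅v r, b⁆ := fun v b ↦ sum_lie _ v b
  have hlie_sum : ∀ (a : Polynomial ℂ ⊗[ℂ] g) (v : ℕ → Polynomial ℂ ⊗[ℂ] g),
      ⁅a, ∑ r ∈ Finset.range m, v r⁆ = ∑ r ∈ Finset.range m, ⁅a, v r⁆ := fun a v ↦ lie_sum _ v a
  set π := Module.End.cyclicAverage τt m with hπ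
  have hπL : ∀ a, π a ∈ Lfix := fun a ↦ (hLfix _).2 (Module.End.apply_cyclicAverage hpow a)
  have hπfix : ∀ a ∈ Lfix, π a = a := fun a ha ↦
    Module.End.cyclicAverage_of_apply_eq_self hm0 ((hLfix a).1 ha)
  have hπlie : ∀ l ∈ Lfix, ∀ a, π ⁅l, a⁆ = ⁅l, π a⁆ := by
    intro l hl a
    have hr : ∀ r : ℕ, (τt ^ r) ⁅l, a⁆ = ⁅l, (τt ^ r) a⁆ := fun r ↦ by
      induction r with
      | zero => rfl
      | succ r ih => rw [pow_succ', Module.End.mul_apply, ih, hτtLie, (hLfix l).1 hl,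
          Module.End.mul_apply]
    have hC : ∀ v : Polynomial ℂ ⊗[ℂ] g, (m : ℂ)⁻¹ • v = Polynomial.C (m : ℂ)⁻¹ • v := fun v ↦ by
      rw [← mul_one (Polynomial.C _), ← Polynomial.smul_eq_C_mul, smul_assoc, one_smul]
    simp only [hπ, Module.End.cyclicAverage_apply, hr, hC, hlie_smul, hlie_sum]
  have hrec := Module.End.sum_X_pow_smul_cyclicAverage hζ.inv hm0 hsemi
  -- the largest `ℂ[t]`-submodule whose average lies in `I`
  let K : Submodule (Polynomial ℂ) (Polynomial ℂ ⊗[ℂ] g) :=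
    { carrier := {a | ∀ p : Polynomial ℂ, π (p • a) ∈ I}
      add_mem' := fun {a b} ha hb p ↦ by
        rw [smul_add, map_add]
        exact I.add_mem (ha p) (hb p)
      zero_mem' := fun p ↦ by simp
      smul_mem' := fun c a ha p ↦ by
        rw [smul_smul]
        exact ha (p * c) }
  have hKI : ∀ a ∈ K, π a ∈ I := fun a ha ↦ by simpa using ha 1
  have hLK : ∀ l ∈ Lfix, ∀ a ∈ K, ⁅l, a⁆ ∈ K := fun l hl a ha p ↦ by
    rw [← hlie_smul, hπlie l hl]
    exact hI l hl _ (ha p)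
  have hXK : ∀ x : g, ∀ b ∈ K, ⁅(Polynomial.X ^ m : Polynomial ℂ) ⊗ₜ[ℂ] x, b⁆ ∈ K := by
    intro x b hb
    have := hrec (1 ⊗ₜ[ℂ] x)
    rw [TensorProduct.smul_tmul', smul_eq_mul, mul_one] at this
    rw [← this, hsum_lie]
    refine K.sum_mem fun j _ ↦ ?_
    rw [hsmul_lie]
    exact K.smul_mem _ (hLK _ (hπL _) b hb)
  have hK : K ≠ ⊥ := by
    obtain ⟨a, ha, ha0⟩ := I.exists_mem_ne_zero_of_ne_bot hI0
    intro hbot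
    have hzero : ∀ l ∈ Lfix, ⁅l, a⁆ = 0 := fun l hl ↦ by
      rw [← Submodule.mem_bot (Polynomial ℂ), ← hbot]
      intro p
      rw [← hsmul_lie, ← hlie_skew, map_neg, hπlie a (hIL ha), hlie_skew]
      exact hI _ (hπL _) a ha
    refine ha0 (LieAlgebra.eq_zero_of_forall_one_tmul_lie_eq_zero fun x ↦ ?_)
    have : (Polynomial.X ^ m : Polynomial ℂ) • ⁅(1 : Polynomial ℂ) ⊗ₜ[ℂ] x, a⁆ = 0 := by
      rw [← hsmul_lie, ← hrec, hsum_lie]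
      refine Finset.sum_eq_zero fun j _ ↦ ?_
      rw [hsmul_lie, hzero _ (hπL _), smul_zero]
    exact (smul_eq_zero.1 this).resolve_left (pow_ne_zero _ Polynomial.X_ne_zero)
  obtain ⟨h, hh, hmem⟩ := LieAlgebra.exists_tmul_mem_of_lie_mem K hK
    (pow_ne_zero m Polynomial.X_ne_zero) hXK
  constructor
  · obtain ⟨q, hq0, hq⟩ := Polynomial.exists_dvd_comp_X_pow hh hm0
    refine ⟨0, hm, _, hq0, ⟨q, rfl⟩, ?_⟩
    rintro a ⟨ha, haL⟩
    rw [← hπfix a haL]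
    refine hKI a ((Submodule.span_le (p := K.restrictScalars ℂ)).2 ?_ ha)
    rintro _ ⟨p, x, rfl⟩
    obtain ⟨u, hu⟩ := hq
    rw [hu, pow_zero, one_mul, mul_assoc, mul_comm, ← smul_eq_mul, ← TensorProduct.smul_tmul']
    exact K.smul_mem _ (hmem x)
  · obtain ⟨W, hW, hWK⟩ := Polynomial.exists_fg_sup_eq_top hh K hmem
    have : FiniteDimensional ℂ ↥((W.map π).map I.mkQ) :=
      Module.Finite.iff_fg.2 ((hW.map π).map I.mkQ)
    refine Submodule.finiteDimensional_of_le (S₂ := (W.map π).map I.mkQ) ?_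
    rintro _ ⟨a, ha, rfl⟩
    obtain ⟨w, hw, b, hb, rfl⟩ := Submodule.mem_sup.1 (hWK ▸ Submodule.mem_top (x := a))
    refine ⟨π w, ⟨w, hw, rfl⟩, ?_⟩
    rw [← hπfix _ ha, map_add, map_add, left_eq_add, Submodule.mkQ_apply,
      Submodule.Quotient.mk_eq_zero]
    exact hKI b hb
end
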